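/- Let 1 < p ≤ q with p > 2, set κ₁ = p−1, κ₂ = q−1, let 0 < ε ≤ 1 and f⃗₁ ∈ Y_{κ₁}(ε), f⃗₂ ∈ Y_{κ₂}(ε), and set w₀ = K[f⃗₁], v₀ = K[f⃗₂]. If (u₁, u₂) ∈ X² × X² satisfies ‖u₁ − w₀‖_{Z²(κ₁)} + ‖u₂ − v₀‖_{Z²(κ₂)} ≤ ε, then ‖R(|∂_t u₂|^p)‖_{Z²(κ₁)} ≤ C ε^p and ‖R(|∂_t u₁|^q)‖_{Z²(κ₂)} ≤ C ε^q, where C is a constant depending only on p and q. -/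

import Mathlib

open Real MeasureTheory Filter

noncomputable section

/-- Partial derivative with respect to the first (radial) variable. -/
def pdr (u : ℝ → ℝ → ℝ) : ℝ → ℝ → ℝ := fun r t => deriv (fun r' => u r' t) r

/-- Partial derivative with respect to the second (time) variable. -/
def pdt (u : ℝ → ℝ → ℝ) : ℝ → ℝ → ℝ := fun r t => deriv (fun t' => u r t') t

/-- `[u(r,t)]₁ = |u| + r (|∂_r u| + |∂_t u|)`. -/
def bracket1 (u : ℝ → ℝ → ℝ) (r t : ℝ) : ℝ :=
  |u r t| + r * (|pdr u r t| + |pdt u r t|)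

/-- `[u(r,t)]₂ = |u| + (1+r)(|∂_r u| + |∂_t u|) + r (|∂_r² u| + |∂_r∂_t u| + |∂_t² u|)`. -/
def bracket2 (u : ℝ → ℝ → ℝ) (r t : ℝ) : ℝ :=
  |u r t| + (1 + r) * (|pdr u r t| + |pdt u r t|) +
    r * (|pdr (pdr u) r t| + |pdr (pdt u) r t| + |pdt (pdt u) r t|)

def bracketS (s : ℕ) (u : ℝ → ℝ → ℝ) (r t : ℝ) : ℝ :=
  if s = 1 then bracket1 u r t else bracket2 u r t

/-- Membership in the class `X^s`: `u ∈ C^{s-1}(ℝ × [0,∞))`, `r u ∈ C^s(ℝ × [0,∞))`,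
and `u` is even in `r`. -/
def memX (s : ℕ) (u : ℝ → ℝ → ℝ) : Prop :=
  ContDiffOn ℝ ((s - 1 : ℕ) : ℕ∞) (fun z : ℝ × ℝ => u z.1 z.2) (Set.univ ×ˢ Set.Ici (0:ℝ)) ∧
  ContDiffOn ℝ ((s : ℕ) : ℕ∞) (fun z : ℝ × ℝ => z.1 * u z.1 z.2) (Set.univ ×ˢ Set.Ici (0:ℝ)) ∧
  ∀ r t : ℝ, 0 ≤ t → u (-r) t = u r t

/-- The set of values whose supremum is `‖u‖_{X^s(ν)}`. -/
def XSet (s : ℕ) (ν : ℝ) (u : ℝ → ℝ → ℝ) : Set ℝ :=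
  {x | ∃ r t : ℝ, 0 < r ∧ 0 ≤ t ∧ x = bracketS s u r t * (1 + |r - t|) ^ ν}

/-- `‖u‖_{X^s(ν)}`. -/
def Xnorm (s : ℕ) (ν : ℝ) (u : ℝ → ℝ → ℝ) : ℝ := sSup (XSet s ν u)

/-- `u ∈ X^s(ν)`. -/
def memXnu (s : ℕ) (ν : ℝ) (u : ℝ → ℝ → ℝ) : Prop := memX s u ∧ BddAbove (XSet s ν u)

/-- The set of values whose supremum is `‖u‖_{Z^s(ν)}`. -/
def ZSet (s : ℕ) (ν : ℝ) (u : ℝ → ℝ → ℝ) : Set ℝ :=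
  {x | ∃ r t : ℝ, 0 < r ∧ 0 ≤ t ∧
    x = bracketS s u r t * (1 + r + t) ^ (ν - 1) * (1 + |r - t|)}

/-- `‖u‖_{Z^s(ν)}`. -/
def Znorm (s : ℕ) (ν : ℝ) (u : ℝ → ℝ → ℝ) : ℝ := sSup (ZSet s ν u)

/-- `u ∈ Z^s(ν)`. -/
def memZnu (s : ℕ) (ν : ℝ) (u : ℝ → ℝ → ℝ) : Prop := memX s u ∧ BddAbove (ZSet s ν u)

/-- `|||f⃗(r)|||`. -/
def tripleNorm (f g : ℝ → ℝ) (r : ℝ) : ℝ :=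
  |f r| + (1 + r) * (|deriv f r| + |g r|) + r * (|deriv (deriv f) r| + |deriv g r|)

def tnorm (fg : (ℝ → ℝ) × (ℝ → ℝ)) (r : ℝ) : ℝ := tripleNorm fg.1 fg.2 r

/-- `f⃗ ∈ Y_ν(ε)`. -/
def memY (ν ε : ℝ) (fg : (ℝ → ℝ) × (ℝ → ℝ)) : Prop :=
  ContDiff ℝ 1 fg.1 ∧ Continuous fg.2 ∧
  (∀ r : ℝ, fg.1 (-r) = fg.1 r) ∧ (∀ r : ℝ, fg.2 (-r) = fg.2 r) ∧
  ContDiff ℝ 2 (fun r : ℝ => r * fg.1 r) ∧ ContDiff ℝ 1 (fun r : ℝ => r * fg.2 r) ∧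
  ∀ r : ℝ, 0 < r → (1 + r) ^ ν * tnorm fg r ≤ ε

/-- Solution operator `K[f⃗]` of the radial homogeneous wave equation. -/
def Kop (fg : (ℝ → ℝ) × (ℝ → ℝ)) : ℝ → ℝ → ℝ := fun r t =>
  (1 / (2 * r)) * ((∫ l in (r - t)..(r + t), l * fg.2 l) +
    deriv (fun s : ℝ => ∫ l in (r - s)..(r + s), l * fg.1 l) t)

/-- Duhamel operator `L(F)` for the initial value problem with zero data. -/
def Lop (F : ℝ → ℝ → ℝ) : ℝ → ℝ → ℝ := fun r t =>
  (1 / (2 * r)) * ∫ s in (0:ℝ)..t, (∫ l in (r - (t - s))..(r + (t - s)), l * F l s)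

/-- Operator `R(F)` associated with the final value problem. -/
def Rop (F : ℝ → ℝ → ℝ) : ℝ → ℝ → ℝ := fun r t =>
  (1 / (2 * r)) * ∫ s in Set.Ioi t, (∫ l in ((s - t) - r)..((s - t) + r), l * F l s)

/-- Values whose supremum is `M₀(F)`. -/
def M0Set (α β γ δ : ℝ) (F : ℝ → ℝ → ℝ) : Set ℝ :=
  {x | ∃ r t : ℝ, 0 < r ∧ 0 ≤ t ∧
    x = |F r t| * r ^ α * (1 + r) ^ β * (1 + r + t) ^ γ * (1 + |r - t|) ^ δ}

/-- Values whose supremum is the second summand of `M₁(F)`. -/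
def M1Set (α β γ δ : ℝ) (F : ℝ → ℝ → ℝ) : Set ℝ :=
  {x | ∃ r t : ℝ, 0 < r ∧ 0 ≤ t ∧
    x = |pdr F r t| * r ^ (α + 1) * (1 + r) ^ (β - 1) * (1 + r + t) ^ γ * (1 + |r - t|) ^ δ}

/-- `M_s(F)` for `s = 0, 1`. -/
def Mnorm (s : ℕ) (α β γ δ : ℝ) (F : ℝ → ℝ → ℝ) : ℝ :=
  if s = 0 then sSup (M0Set α β γ δ F)
  else sSup (M0Set α β γ δ F) + sSup (M1Set α β γ δ F)

/-- Finiteness of `M_s(F)`. -/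
def MFinite (s : ℕ) (α β γ δ : ℝ) (F : ℝ → ℝ → ℝ) : Prop :=
  BddAbove (M0Set α β γ δ F) ∧ (s = 0 ∨ BddAbove (M1Set α β γ δ F))

/-- Energy norm `‖w(t)‖_E` of the radial function `w(|x|,t)` on `ℝ³`. -/
def energy (w : ℝ → ℝ → ℝ) (t : ℝ) : ℝ :=
  Real.sqrt ((1 / 2) * ∫ x : EuclideanSpace ℝ (Fin 3),
    ((pdt w ‖x‖ t) ^ 2 + (pdr w ‖x‖ t) ^ 2))

/-- The nonlinearity `|∂_t u|^p`. -/
def NLt (p : ℝ) (u : ℝ → ℝ → ℝ) : ℝ → ℝ → ℝ := fun r t => |pdt u r t| ^ p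

/-- `(u₁,u₂)` solves the radially symmetric system (S). -/
def solvesS (p q : ℝ) (u₁ u₂ : ℝ → ℝ → ℝ) : Prop :=
  ∀ r t : ℝ, 0 < r → 0 ≤ t →
    pdt (pdt u₁) r t - (pdr (pdr u₁) r t + (2 / r) * pdr u₁ r t) = |pdt u₂ r t| ^ p ∧
    pdt (pdt u₂) r t - (pdr (pdr u₂) r t + (2 / r) * pdr u₂ r t) = |pdt u₁ r t| ^ q

/-- Initial data `(u(·,0), ∂_t u(·,0))` of a function `u(r,t)`. -/
def datum (u : ℝ → ℝ → ℝ) : (ℝ → ℝ) × (ℝ → ℝ) := (fun r => u r 0, fun r => pdt u r 0)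

/-- The sequence `a₀ = 1`, `a_{j+1} = κ₁ (a_j - 1) + κ₂`. -/
def aseq (κ₁ κ₂ : ℝ) : ℕ → ℝ
  | 0 => 1
  | n + 1 => κ₁ * (aseq κ₁ κ₂ n - 1) + κ₂

/-- Auxiliary iteration producing the pairs `((w_j, v_j), (w_{j+1}, v_{j+1}))`. -/
def iterAux (p q : ℝ) (fg1 fg2 : (ℝ → ℝ) × (ℝ → ℝ)) :
    ℕ → ((ℝ → ℝ → ℝ) × (ℝ → ℝ → ℝ)) × ((ℝ → ℝ → ℝ) × (ℝ → ℝ → ℝ))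
  | 0 =>
    ((Kop fg1, Kop fg2),
     (Kop fg1 + Lop (NLt p (Kop fg2)),
      Kop fg2 + Rop (NLt q (Kop fg1 + Lop (NLt p (Kop fg2))))))
  | n + 1 =>
    let prev := iterAux p q fg1 fg2 n
    let wnext := prev.2.1 + Lop (NLt p prev.2.2 - NLt p prev.1.2)
    (prev.2, (wnext, prev.2.2 + Rop (NLt q wnext - NLt q prev.2.1)))

/-- The iterate `w_j`. -/
def witer (p q : ℝ) (fg1 fg2 : (ℝ → ℝ) × (ℝ → ℝ)) (j : ℕ) : ℝ → ℝ → ℝ :=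
  (iterAux p q fg1 fg2 j).1.1

/-- The iterate `v_j`. -/
def viter (p q : ℝ) (fg1 fg2 : (ℝ → ℝ) × (ℝ → ℝ)) (j : ℕ) : ℝ → ℝ → ℝ :=
  (iterAux p q fg1 fg2 j).1.2

/-- The starred iterates `(w_j^*, v_j^*)` built from a solution `(u₁,u₂)`. -/
def starIter (p q : ℝ) (φ1 : (ℝ → ℝ) × (ℝ → ℝ)) (u₁ u₂ : ℝ → ℝ → ℝ) :
    ℕ → (ℝ → ℝ → ℝ) × (ℝ → ℝ → ℝ)
  | 0 => (Kop φ1, u₂ - Rop (NLt q u₁))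
  | n + 1 =>
    let w := Kop φ1 + Lop (NLt p (starIter p q φ1 u₁ u₂ n).2)
    (w, (u₂ - Rop (NLt q u₁)) + Rop (NLt q w))

/-- The quantity `d₁(w, 0) = ‖w‖_{Z²(κ₁ a_{ℓ+1})} + ‖w‖_{Z¹(κ₁ a_{ℓ+1})}^{p-1}` (applied to
differences). -/
def dOne (p q : ℝ) (ℓ : ℕ) (w : ℝ → ℝ → ℝ) : ℝ :=
  Znorm 2 ((p - 1) * aseq (p - 1) (q * (p - 1) - 1) (ℓ + 1)) w +
    Znorm 1 ((p - 1) * aseq (p - 1) (q * (p - 1) - 1) (ℓ + 1)) w ^ (p - 1)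

/-- The quantity `d₂(w, 0) = ‖w‖_{Z²(a_{ℓ+1})} + ‖w‖_{Z¹(a_{ℓ+1})}^{p-1}` (applied to
differences). -/
def dTwo (p q : ℝ) (ℓ : ℕ) (w : ℝ → ℝ → ℝ) : ℝ :=
  Znorm 2 (aseq (p - 1) (q * (p - 1) - 1) (ℓ + 1)) w +
    Znorm 1 (aseq (p - 1) (q * (p - 1) - 1) (ℓ + 1)) w ^ (p - 1)

/-- Membership in the metric ball `D_ε` around `(w_{ℓ+1}, v_{ℓ+1})`. -/
def memD (p q ε : ℝ) (ℓ : ℕ) (fg1 fg2 : (ℝ → ℝ) × (ℝ → ℝ)) (u₁ u₂ : ℝ → ℝ → ℝ) : Prop :=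
  memX 2 u₁ ∧ memX 2 u₂ ∧
  BddAbove (ZSet 2 ((p - 1) * aseq (p - 1) (q * (p - 1) - 1) (ℓ + 1))
    (u₁ - witer p q fg1 fg2 (ℓ + 1))) ∧
  BddAbove (ZSet 1 ((p - 1) * aseq (p - 1) (q * (p - 1) - 1) (ℓ + 1))
    (u₁ - witer p q fg1 fg2 (ℓ + 1))) ∧
  BddAbove (ZSet 2 (aseq (p - 1) (q * (p - 1) - 1) (ℓ + 1))
    (u₂ - viter p q fg1 fg2 (ℓ + 1))) ∧
  BddAbove (ZSet 1 (aseq (p - 1) (q * (p - 1) - 1) (ℓ + 1))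
    (u₂ - viter p q fg1 fg2 (ℓ + 1))) ∧
  dOne p q ℓ (u₁ - witer p q fg1 fg2 (ℓ + 1)) + dTwo p q ℓ (u₂ - viter p q fg1 fg2 (ℓ + 1))
    ≤ ε ^ ((p - 1) * (q + (ℓ : ℝ) * (p + q - 2)))

section Helpers

open Set Topology


lemma chain_partials {f fx ft : ℝ → ℝ → ℝ}
    (hx : ∀ x t, HasDerivAt (fun y => f y t) (fx x t) x)
    (ht : ∀ x t, HasDerivAt (fun s => f x s) (ft x t) t)
    (cx : Continuous (fun z : ℝ × ℝ => fx z.1 z.2))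
    (ct : Continuous (fun z : ℝ × ℝ => ft z.1 z.2))
    {a b : ℝ → ℝ} {a' b' s : ℝ} (ha : HasDerivAt a a' s) (hb : HasDerivAt b b' s) :
    HasDerivAt (fun s => f (a s) (b s)) (fx (a s) (b s) * a' + ft (a s) (b s) * b') s := by
  have key := hasStrictFDerivAt_uncurry_coprod (𝕜 := ℝ) (u := (a s, b s)) (f := f)
    (f₁ := fun x t => ContinuousLinearMap.toSpanSingleton ℝ (fx x t))
    (f₂ := fun x t => ContinuousLinearMap.toSpanSingleton ℝ (ft x t))
    (Filter.Eventually.of_forall fun v => (hx v.1 v.2).hasFDerivAt)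
    (Filter.Eventually.of_forall fun v => (ht v.1 v.2).hasFDerivAt)
    (by
      apply Continuous.continuousAt
      exact (ContinuousLinearMap.toSpanSingletonCLE (𝕜 := ℝ) (E := ℝ)).continuous.comp cx)
    (by
      apply Continuous.continuousAt
      exact (ContinuousLinearMap.toSpanSingletonCLE (𝕜 := ℝ) (E := ℝ)).continuous.comp ct)
  have h2 := key.hasFDerivAt.comp_hasDerivAt s (f := fun s => (a s, b s)) (ha.prodMk hb)
  have e : fx (a s) (b s) * a' + ft (a s) (b s) * b' =
      a' * fx (a s) (b s) + b' * ft (a s) (b s) := by ring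
  rw [e]
  exact h2

lemma cont_partials {f fx ft : ℝ → ℝ → ℝ}
    (hx : ∀ x t, HasDerivAt (fun y => f y t) (fx x t) x)
    (ht : ∀ x t, HasDerivAt (fun s => f x s) (ft x t) t)
    (cx : Continuous (fun z : ℝ × ℝ => fx z.1 z.2))
    (ct : Continuous (fun z : ℝ × ℝ => ft z.1 z.2)) :
    Continuous (fun z : ℝ × ℝ => f z.1 z.2) := by
  rw [continuous_iff_continuousAt]
  intro u
  have key := hasStrictFDerivAt_uncurry_coprod (𝕜 := ℝ) (u := u) (f := f)
    (f₁ := fun x t => ContinuousLinearMap.toSpanSingleton ℝ (fx x t))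
    (f₂ := fun x t => ContinuousLinearMap.toSpanSingleton ℝ (ft x t))
    (Filter.Eventually.of_forall fun v => (hx v.1 v.2).hasFDerivAt)
    (Filter.Eventually.of_forall fun v => (ht v.1 v.2).hasFDerivAt)
    (by
      apply Continuous.continuousAt
      exact (ContinuousLinearMap.toSpanSingletonCLE (𝕜 := ℝ) (E := ℝ)).continuous.comp cx)
    (by
      apply Continuous.continuousAt
      exact (ContinuousLinearMap.toSpanSingletonCLE (𝕜 := ℝ) (E := ℝ)).continuous.comp ct)
  exact key.hasFDerivAt.continuousAt

/-- Kernel hypotheses. -/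
structure KerBd (κ A : ℝ) (k : ℝ → ℝ → ℝ) : Prop where
  cont : Continuous (fun z : ℝ × ℝ => k z.1 z.2)
  b0 : ∀ l s, |k l s| ≤ A * (1 + |l|) ^ (-κ)
  b : ∀ l s, 0 ≤ s → |k l s| ≤ A * ((1 + |l|) ^ (-κ) * (1 + |(|l| - s)|) ^ (-(κ + 1)))

def Pk (k : ℝ → ℝ → ℝ) (r t : ℝ) : ℝ := ∫ τ in Ioi (0:ℝ), k (τ + r) (τ + t)

lemma jap_int {κ : ℝ} (hκ : 1 < κ) : Integrable (fun s : ℝ => (1 + |s|) ^ (-κ)) := by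
  have := integrable_one_add_norm (E := ℝ) (μ := volume) (r := κ) (by simpa using hκ)
  simpa using this

lemma jap_shift {κ : ℝ} (hκ : 1 < κ) (x : ℝ) : Integrable (fun s : ℝ => (1 + |s + x|) ^ (-κ)) :=
  (jap_int hκ).comp_add_right x

lemma jap_cmp {κ : ℝ} (hκ : 0 < κ) {a b c : ℝ} (hc : 0 ≤ c) (h : |a - b| ≤ c) :
    (1 + |b|) ^ (-κ) ≤ (1 + c) ^ κ * (1 + |a|) ^ (-κ) := by
  have h1 : 1 + |a| ≤ (1 + c) * (1 + |b|) := by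
    have : |a| ≤ |b| + c := by
      have := abs_sub_abs_le_abs_sub a b
      linarith
    nlinarith [abs_nonneg b]
  have pa : 0 < 1 + |a| := by positivity
  have pb : 0 < 1 + |b| := by positivity
  have h2 : (1 + |a|) ^ κ ≤ (1 + c) ^ κ * (1 + |b|) ^ κ := by
    rw [← Real.mul_rpow (by positivity) (by positivity)]
    exact Real.rpow_le_rpow pa.le h1 hκ.le
  rw [Real.rpow_neg pa.le, Real.rpow_neg pb.le, ← div_eq_mul_inv, inv_eq_one_div]
  rw [div_le_div_iff₀ (by positivity) (by positivity)]
  linarith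

section
variable {κ A : ℝ} {k h h1 : ℝ → ℝ → ℝ}

lemma KerBd.A_nonneg (H : KerBd κ A k) : 0 ≤ A := by
  have := (abs_nonneg _).trans (H.b0 0 0)
  simpa using this

lemma KerBd.intg (hκ : 1 < κ) (H : KerBd κ A k) (r t : ℝ) :
    Integrable (fun τ => k (τ + r) (τ + t)) := by
  refine ((jap_shift hκ r).const_mul A).mono' ?_ ?_
  · exact (H.cont.comp (f := fun τ : ℝ => (τ + r, τ + t)) (by fun_prop)).aestronglyMeasurable
  · exact Filter.Eventually.of_forall fun τ => H.b0 _ _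

lemma Pk_eq (k : ℝ → ℝ → ℝ) (r t : ℝ) : Pk k r t = ∫ s in Ioi t, k (s - t + r) s := by
  unfold Pk
  have := (measurePreserving_add_right volume t).setIntegral_preimage_emb
    (measurableEmbedding_addRight t) (fun s => k (s - t + r) s) (Ioi t)
  rw [← this]
  simp

lemma KerBd.Pk_cont (hκ : 1 < κ) (H : KerBd κ A k) :
    Continuous (fun z : ℝ × ℝ => Pk k z.1 z.2) := by
  rw [continuous_iff_continuousAt]
  intro z₀
  refine continuousAt_of_dominated (bound := fun τ => A * ((1 + 1) ^ κ * (1 + |τ + z₀.1|) ^ (-κ)))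
    ?_ ?_ ?_ ?_
  · exact Filter.Eventually.of_forall fun z => (H.intg hκ z.1 z.2).aestronglyMeasurable.restrict
  · have : ∀ᶠ z : ℝ × ℝ in 𝓝 z₀, z.1 ∈ Metric.ball z₀.1 1 :=
      continuous_fst.continuousAt.eventually_mem (Metric.ball_mem_nhds _ one_pos)
    filter_upwards [this] with z hz
    refine Filter.Eventually.of_forall fun τ => (H.b0 _ _).trans ?_
    refine mul_le_mul_of_nonneg_left ?_ H.A_nonneg
    refine jap_cmp (by linarith) zero_le_one ?_
    rw [Metric.mem_ball, Real.dist_eq, abs_sub_comm] at hz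
    rw [show τ + z₀.1 - (τ + z.1) = z₀.1 - z.1 by ring]
    exact hz.le
  · exact (((jap_shift hκ z₀.1).const_mul _).const_mul A).integrableOn
  · exact Filter.Eventually.of_forall fun τ =>
      (H.cont.comp (f := fun z : ℝ × ℝ => (τ + z.1, τ + z.2)) (by fun_prop)).continuousAt

lemma Pk_deriv_r (hκ : 1 < κ) (H : KerBd κ A h) (H1 : KerBd κ A h1)
    (hd : ∀ l s, HasDerivAt (fun l => h l s) (h1 l s) l) (r t : ℝ) :
    HasDerivAt (fun r => Pk h r t) (Pk h1 r t) r := by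
  refine (hasDerivAt_integral_of_dominated_loc_of_deriv_le
    (bound := fun τ => A * ((1 + 1) ^ κ * (1 + |τ + r|) ^ (-κ)))
    (F := fun r τ => h (τ + r) (τ + t)) (F' := fun r τ => h1 (τ + r) (τ + t))
    (Metric.ball_mem_nhds r one_pos) ?_ ?_ ?_ ?_ ?_ ?_).2
  · exact Filter.Eventually.of_forall fun z => (H.intg hκ z t).aestronglyMeasurable.restrict
  · exact (H.intg hκ r t).integrableOn
  · exact (H1.intg hκ r t).aestronglyMeasurable.restrict
  · refine Filter.Eventually.of_forall fun τ x hx => (H1.b0 _ _).trans ?_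
    refine mul_le_mul_of_nonneg_left ?_ H.A_nonneg
    refine jap_cmp (by linarith) zero_le_one ?_
    rw [Metric.mem_ball, Real.dist_eq, abs_sub_comm] at hx
    rw [show τ + r - (τ + x) = r - x by ring]
    exact hx.le
  · exact (((jap_shift hκ r).const_mul _).const_mul A).integrableOn
  · refine Filter.Eventually.of_forall fun τ x hx => ?_
    exact (hd (τ + x) (τ + t)).comp_const_add τ x

lemma Pk_deriv_t (hκ : 1 < κ) (H : KerBd κ A h) (H1 : KerBd κ A h1)
    (hd : ∀ l s, HasDerivAt (fun l => h l s) (h1 l s) l) (r t : ℝ) :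
    HasDerivAt (fun t => Pk h r t) (-h r t - Pk h1 r t) t := by
  have e : ∀ x t, Pk h (x + t) t = ∫ s in Ioi t, h (s + x) s := by
    intro x t
    rw [Pk_eq]
    congr 1; ext s; congr 1; ring
  have hi : ∀ x, Integrable (fun s => h (s + x) s) := fun x => by
    simpa using H.intg hκ x 0
  have dt : ∀ x t, HasDerivAt (fun s => Pk h (x + s) s) (-h (x + t) t) t := by
    intro x t
    have c : Continuous (fun s => h (s + x) s) :=
      H.cont.comp (f := fun s : ℝ => (s + x, s)) (by fun_prop)
    have h0 : (fun s => Pk h (x + s) s) =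
        fun s => (∫ u in Ioi (0:ℝ), h (u + x) u) - ∫ u in (0:ℝ)..s, h (u + x) u := by
      ext s
      rw [e, ← intervalIntegral.integral_Ioi_sub_Ioi' (hi x).integrableOn (hi x).integrableOn]
      ring
    rw [h0]
    have := (c.integral_hasStrictDerivAt 0 t).hasDerivAt.const_sub
      (∫ u in Ioi (0:ℝ), h (u + x) u)
    rwa [add_comm t x] at this
  have dx : ∀ x t, HasDerivAt (fun y => Pk h (y + t) t) (Pk h1 (x + t) t) x := fun x t =>
    (Pk_deriv_r hκ H H1 hd (x + t) t).comp_add_const x t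
  have := chain_partials (f := fun x t => Pk h (x + t) t) (fx := fun x t => Pk h1 (x + t) t)
    (ft := fun x t => -h (x + t) t) dx dt
    ((H1.Pk_cont hκ).comp (f := fun z : ℝ × ℝ => (z.1 + z.2, z.2)) (by fun_prop))
    ((H.cont.comp (f := fun z : ℝ × ℝ => (z.1 + z.2, z.2)) (by fun_prop)).neg)
    (a := fun s => r - s) (b := fun s => s) (s := t) ((hasDerivAt_id t).const_sub r)
    (hasDerivAt_id t)
  simp only [sub_add_cancel] at this
  convert this using 1
  ring

end


lemma rneg {X Y c a : ℝ} (hX : 0 < X) (hY : 0 < Y) (hc : 0 ≤ c) (ha : 0 ≤ a) (h : X ≤ c * Y) :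
    Y ^ (-a) ≤ c ^ a * X ^ (-a) := by
  have h2 : X ^ a ≤ c ^ a * Y ^ a := by
    rw [← Real.mul_rpow hc hY.le]
    exact Real.rpow_le_rpow hX.le h ha
  rw [Real.rpow_neg hX.le, Real.rpow_neg hY.le, ← div_eq_mul_inv, inv_eq_one_div]
  rw [div_le_div_iff₀ (by positivity) (by positivity)]
  linarith

lemma half_sum {r t : ℝ} (hr : 0 ≤ r) :
    1 + r + t ≤ 2 * ((1 + r) * (1 + |r - t|)) := by
  have := neg_abs_le (r - t)
  have := abs_nonneg (r - t)
  nlinarith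

def Jap (κ : ℝ) : ℝ := ∫ x : ℝ, (1 + |x|) ^ (-κ)

lemma Jap_nonneg (κ : ℝ) : 0 ≤ Jap κ := integral_nonneg fun x => by positivity

lemma Jap_shift (κ x : ℝ) : ∫ s : ℝ, (1 + |s + x|) ^ (-κ) = Jap κ :=
  integral_add_right_eq_self (fun s : ℝ => (1 + |s|) ^ (-κ)) x

lemma weight1 {κ : ℝ} (hκ : 1 < κ) {r t : ℝ} (hr : 0 ≤ r) (ht : 0 ≤ t) :
    (1 + r) ^ (-(κ - 1)) * (1 + |r - t|) ^ (-(κ + 1)) ≤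
      2 ^ (κ - 1) * ((1 + r + t) ^ (-(κ - 1)) * (1 + |r - t|) ^ (-(2:ℝ))) := by
  have hb : 0 < 1 + |r - t| := by positivity
  have e : (1 + |r - t|) ^ (-(κ + 1)) = (1 + |r - t|) ^ (-(κ - 1)) * (1 + |r - t|) ^ (-(2:ℝ)) := by
    rw [← Real.rpow_add hb]; congr 1; ring
  rw [e, ← mul_assoc, ← mul_assoc, ← Real.mul_rpow (by positivity) hb.le]
  refine mul_le_mul_of_nonneg_right ?_ (by positivity)
  exact rneg (by positivity) (by positivity) (by norm_num) (by linarith) (half_sum hr)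

section
variable {κ A : ℝ} {k h h1 : ℝ → ℝ → ℝ}

lemma KerBd.Pk_pos (hκ : 1 < κ) (H : KerBd κ A k) {r t : ℝ} (hr : 0 ≤ r) (ht : 0 ≤ t) :
    |Pk k r t| ≤ 2 ^ (κ - 1) / (κ - 1) * A *
      ((1 + r + t) ^ (-(κ - 1)) * (1 + |r - t|) ^ (-(2:ℝ))) := by
  have hA := H.A_nonneg
  have hI : ∫ τ in Ioi (0:ℝ), (τ + (1 + r)) ^ (-κ) = (1 + r) ^ (-(κ - 1)) / (κ - 1) := by
    have := (measurePreserving_add_right volume (1 + r)).setIntegral_preimage_emb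
      (measurableEmbedding_addRight (1 + r)) (fun s => s ^ (-κ)) (Ioi (1 + r))
    simp only [preimage_add_const_Ioi, sub_self] at this
    rw [this, integral_Ioi_rpow_of_lt (by linarith) (by linarith)]
    rw [show -κ + 1 = -(κ - 1) by ring, neg_div_neg_eq]
  have hInt0 : IntegrableOn (fun τ : ℝ => (τ + (1 + r)) ^ (-κ)) (Ioi 0) :=
    integrableOn_add_rpow_Ioi_of_lt (by linarith) (by linarith)
  have h1 : |Pk k r t| ≤ ∫ τ in Ioi (0:ℝ),
      A * (1 + |r - t|) ^ (-(κ + 1)) * (τ + (1 + r)) ^ (-κ) := by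
    rw [← Real.norm_eq_abs]
    refine norm_integral_le_of_norm_le (hInt0.const_mul _) ?_
    refine (ae_restrict_iff' measurableSet_Ioi).2 (Filter.Eventually.of_forall fun τ hτ => ?_)
    have hτ : 0 < τ := hτ
    refine (H.b _ _ (by linarith)).trans (le_of_eq ?_)
    rw [abs_of_pos (show 0 < τ + r by linarith)]
    rw [show τ + r - (τ + t) = r - t by ring, show 1 + (τ + r) = τ + (1 + r) by ring]
    ring
  rw [integral_const_mul, hI] at h1
  refine h1.trans ?_
  have := weight1 hκ hr ht
  have hk : 0 < κ - 1 := by linarith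
  calc _ = A / (κ - 1) * ((1 + r) ^ (-(κ - 1)) * (1 + |r - t|) ^ (-(κ + 1))) := by ring
    _ ≤ A / (κ - 1) * (2 ^ (κ - 1) * ((1 + r + t) ^ (-(κ - 1)) * (1 + |r - t|) ^ (-(2:ℝ)))) :=
        mul_le_mul_of_nonneg_left this (by positivity)
    _ = _ := by ring

lemma KerBd.Pk_neg (hκ : 1 < κ) (H : KerBd κ A k) {r t : ℝ} (hr : 0 ≤ r) (ht : 0 ≤ t) :
    |Pk k (-r) t| ≤ 3 ^ (κ + 1) * (Jap κ + Jap (κ + 1)) * A * (1 + r + t) ^ (-κ) := by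
  have hA := H.A_nonneg
  set N := 1 + r + t with hN
  have N1 : 1 ≤ N := by linarith
  have hκ' : 1 < κ + 1 := by linarith
  have key : |Pk k (-r) t| ≤ ∫ τ in Ioi (0:ℝ), A * (3 ^ (κ + 1) * N ^ (-κ)) *
      ((1 + |τ + (-r)|) ^ (-κ) + (1 + |τ + (t - r) / 2|) ^ (-(κ + 1))) := by
    rw [← Real.norm_eq_abs]
    refine norm_integral_le_of_norm_le
      (((jap_shift hκ _).add (jap_shift hκ' _)).const_mul _).integrableOn ?_
    refine (ae_restrict_iff' measurableSet_Ioi).2 (Filter.Eventually.of_forall fun τ hτ => ?_)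
    have hτ : 0 < τ := hτ
    refine (H.b _ _ (by linarith)).trans ?_
    rw [mul_assoc]
    refine mul_le_mul_of_nonneg_left ?_ hA
    set α := 1 + |τ + -r| with hα
    set β := 1 + |(|τ + -r| - (τ + t))| with hβ
    set γ := 1 + |τ + (t - r) / 2| with hγ
    have α1 : 1 ≤ α := by simp [hα]
    have β1 : 1 ≤ β := by simp [hβ]
    have γ1 : 1 ≤ γ := by simp [hγ]
    have hNab : N ≤ 2 * α + β := by
      have := neg_abs_le (|τ + -r| - (τ + t))
      have := neg_abs_le (τ + -r)
      linarith
    have caseB : N ≤ 3 * β → α ^ (-κ) * β ^ (-(κ + 1)) ≤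
        3 ^ (κ + 1) * N ^ (-κ) * (α ^ (-κ) + γ ^ (-(κ + 1))) := by
      intro hb
      have h1 := rneg (a := κ + 1) (by linarith) (by linarith : 0 < β) (by norm_num)
        (by linarith) hb
      have h2 : N ^ (-(κ + 1)) ≤ N ^ (-κ) := Real.rpow_le_rpow_of_exponent_le N1 (by linarith)
      have h3 : β ^ (-(κ + 1)) ≤ 3 ^ (κ + 1) * N ^ (-κ) :=
        h1.trans (mul_le_mul_of_nonneg_left h2 (by positivity))
      calc _ ≤ α ^ (-κ) * (3 ^ (κ + 1) * N ^ (-κ)) :=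
            mul_le_mul_of_nonneg_left h3 (by positivity)
        _ = 3 ^ (κ + 1) * N ^ (-κ) * (α ^ (-κ)) := by ring
        _ ≤ _ := by
          refine mul_le_mul_of_nonneg_left ?_ (by positivity)
          have : 0 ≤ γ ^ (-(κ + 1)) := by positivity
          linarith
    by_cases hb : N ≤ 3 * β
    · exact caseB hb
    · push Not at hb
      have ha : N ≤ 3 * α := by linarith
      rcases le_or_gt τ r with hτr | hτr
      · have hl : |τ + -r| = r - τ := by rw [abs_of_nonpos (by linarith)]; ring
        have hγβ : γ ≤ β := by
          rw [hβ, hl, hγ, show r - τ - (τ + t) = (-2) * (τ + (t - r) / 2) by ring, abs_mul]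
          have := abs_nonneg (τ + (t - r) / 2)
          norm_num
          linarith
        have h1 := rneg (a := κ) (by linarith) (by linarith : 0 < α) (by norm_num)
          (by linarith) ha
        have h2 : β ^ (-(κ + 1)) ≤ γ ^ (-(κ + 1)) :=
          Real.rpow_le_rpow_of_nonpos (by linarith) hγβ (by linarith)
        have h3 : (3:ℝ) ^ κ ≤ 3 ^ (κ + 1) :=
          Real.rpow_le_rpow_of_exponent_le (by norm_num) (by linarith)
        calc _ ≤ (3 ^ κ * N ^ (-κ)) * γ ^ (-(κ + 1)) :=
              mul_le_mul h1 h2 (by positivity) (by positivity)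
          _ ≤ 3 ^ (κ + 1) * N ^ (-κ) * γ ^ (-(κ + 1)) := by gcongr
          _ ≤ _ := by
            refine mul_le_mul_of_nonneg_left ?_ (by positivity)
            have : 0 ≤ α ^ (-κ) := by positivity
            linarith
      · refine caseB ?_
        have hl : |τ + -r| = τ - r := by rw [abs_of_pos (by linarith)]; ring
        rw [hβ, hl, show τ - r - (τ + t) = -(r + t) by ring, abs_neg, abs_of_nonneg (by linarith)]
        linarith
  refine key.trans ?_
  have h2 : (∫ τ in Ioi (0:ℝ), A * (3 ^ (κ + 1) * N ^ (-κ)) *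
      ((1 + |τ + (-r)|) ^ (-κ) + (1 + |τ + (t - r) / 2|) ^ (-(κ + 1)))) ≤
      ∫ τ : ℝ, A * (3 ^ (κ + 1) * N ^ (-κ)) *
      ((1 + |τ + (-r)|) ^ (-κ) + (1 + |τ + (t - r) / 2|) ^ (-(κ + 1))) :=
    setIntegral_le_integral (((jap_shift hκ _).add (jap_shift hκ' _)).const_mul _)
      (Filter.Eventually.of_forall fun τ => by
        have : 0 ≤ N := by linarith
        simp only [Pi.zero_apply]
        positivity)
  refine h2.trans (le_of_eq ?_)
  rw [integral_const_mul, integral_add (jap_shift hκ _) (jap_shift hκ' _), Jap_shift, Jap_shift]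
  ring

/-- target weight -/
def Tw (κ r t : ℝ) : ℝ := (1 + r + t) ^ (-(κ - 1)) * (1 + |r - t|)⁻¹

lemma Tw_pos {κ r t : ℝ} (hr : 0 ≤ r) (ht : 0 ≤ t) : 0 < Tw κ r t := by
  unfold Tw; positivity

def Cb (κ : ℝ) : ℝ := 2 ^ (κ - 1) / (κ - 1) + 3 ^ (κ + 1) * (Jap κ + Jap (κ + 1)) + 2 ^ (κ - 1)

lemma Cb_parts (hκ : 1 < κ) : 0 ≤ (2:ℝ) ^ (κ - 1) / (κ - 1) ∧
    0 ≤ 3 ^ (κ + 1) * (Jap κ + Jap (κ + 1)) ∧ 0 < (2:ℝ) ^ (κ - 1) := by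
  have : 0 < κ - 1 := by linarith
  have := Jap_nonneg κ
  have := Jap_nonneg (κ + 1)
  refine ⟨by positivity, by positivity, by positivity⟩

lemma sq_le_inv {x : ℝ} (hx : 1 ≤ x) : x ^ (-(2:ℝ)) ≤ x⁻¹ := by
  rw [← Real.rpow_neg_one]
  exact Real.rpow_le_rpow_of_exponent_le hx (by norm_num)

lemma KerBd.Pk_pos' (hκ : 1 < κ) (H : KerBd κ A k) {r t : ℝ} (hr : 0 ≤ r) (ht : 0 ≤ t) :
    |Pk k r t| ≤ Cb κ * A * Tw κ r t := by
  obtain ⟨c1, c2, c3⟩ := Cb_parts hκ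
  have hA := H.A_nonneg
  have hC : 0 ≤ Cb κ := by unfold Cb; linarith
  refine (H.Pk_pos hκ hr ht).trans ?_
  have : 2 ^ (κ - 1) / (κ - 1) ≤ Cb κ := by unfold Cb; linarith
  have h2 : (1 + |r - t|) ^ (-(2:ℝ)) ≤ (1 + |r - t|)⁻¹ := sq_le_inv (by simp)
  unfold Tw
  gcongr

lemma KerBd.Pk_neg' (hκ : 1 < κ) (H : KerBd κ A k) {r t : ℝ} (hr : 0 ≤ r) (ht : 0 ≤ t) :
    |Pk k (-r) t| ≤ Cb κ * A * Tw κ r t := by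
  obtain ⟨c1, c2, c3⟩ := Cb_parts hκ
  have hA := H.A_nonneg
  have hC : 0 ≤ Cb κ := by unfold Cb; linarith
  refine (H.Pk_neg hκ hr ht).trans ?_
  have : 3 ^ (κ + 1) * (Jap κ + Jap (κ + 1)) ≤ Cb κ := by unfold Cb; linarith
  have hN : 0 < 1 + r + t := by positivity
  have h2 : (1 + r + t) ^ (-κ) ≤ Tw κ r t := by
    unfold Tw
    rw [show -κ = -(κ - 1) + -1 by ring, Real.rpow_add hN, Real.rpow_neg_one]
    refine mul_le_mul_of_nonneg_left ?_ (by positivity)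
    refine inv_anti₀ (by positivity) ?_
    have : |r - t| ≤ r + t := abs_le.2 ⟨by linarith, by linarith⟩
    linarith
  gcongr

lemma KerBd.ker' (hκ : 1 < κ) (H : KerBd κ A k) {r t : ℝ} (hr : 0 ≤ r) (ht : 0 ≤ t) :
    |k r t| ≤ Cb κ * A * Tw κ r t := by
  obtain ⟨c1, c2, c3⟩ := Cb_parts hκ
  have hA := H.A_nonneg
  have hC : 0 ≤ Cb κ := by unfold Cb; linarith
  have h1 := H.b r t ht
  rw [abs_of_nonneg hr] at h1
  have : 2 ^ (κ - 1) ≤ Cb κ := by unfold Cb; linarith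
  have h2 : (1 + |r - t|) ^ (-(2:ℝ)) ≤ (1 + |r - t|)⁻¹ := sq_le_inv (by simp)
  have h3 : (1 + r) ^ (-κ) ≤ (1 + r) ^ (-(κ - 1)) :=
    Real.rpow_le_rpow_of_exponent_le (by linarith) (by linarith)
  calc _ ≤ A * ((1 + r) ^ (-κ) * (1 + |r - t|) ^ (-(κ + 1))) := h1
    _ ≤ A * ((1 + r) ^ (-(κ - 1)) * (1 + |r - t|) ^ (-(κ + 1))) := by gcongr
    _ ≤ A * (2 ^ (κ - 1) * ((1 + r + t) ^ (-(κ - 1)) * (1 + |r - t|) ^ (-(2:ℝ)))) :=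
      mul_le_mul_of_nonneg_left (weight1 hκ hr ht) hA
    _ ≤ A * (Cb κ * ((1 + r + t) ^ (-(κ - 1)) * (1 + |r - t|)⁻¹)) := by gcongr
    _ = _ := by unfold Tw; ring

lemma Tw_cmp (hκ : 1 < κ) {σ r t : ℝ} (hσ : 0 ≤ σ) (hσr : σ ≤ r) (hr : r ≤ 1) (ht : 0 ≤ t) :
    Tw κ σ t ≤ 2 ^ κ * Tw κ r t := by
  unfold Tw
  have h1 : (1 + σ + t) ^ (-(κ - 1)) ≤ 2 ^ (κ - 1) * (1 + r + t) ^ (-(κ - 1)) :=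
    rneg (by linarith) (by linarith) (by norm_num) (by linarith) (by linarith)
  have h2 : (1 + |σ - t|)⁻¹ ≤ 2 * (1 + |r - t|)⁻¹ := by
    have : |r - t| ≤ |σ - t| + 1 := by
      have := abs_sub_abs_le_abs_sub (r - t) (σ - t)
      rw [show r - t - (σ - t) = r - σ by ring, abs_of_nonneg (show 0 ≤ r - σ by linarith)] at this
      linarith
    have p1 : 0 < 1 + |σ - t| := by positivity
    have p2 : 0 < 1 + |r - t| := by positivity
    rw [← div_eq_mul_inv, inv_eq_one_div, div_le_div_iff₀ p1 p2]
    linarith [abs_nonneg (σ - t)]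
  have e : (2:ℝ) ^ κ = 2 ^ (κ - 1) * 2 := by
    rw [← Real.rpow_add_one (by norm_num)]; congr 1; ring
  rw [e]
  have hr0 : 0 ≤ r := hσ.trans hσr
  calc _ ≤ (2 ^ (κ - 1) * (1 + r + t) ^ (-(κ - 1))) * (2 * (1 + |r - t|)⁻¹) := by gcongr
    _ = _ := by ring
end


section
variable {κ A : ℝ} {k h h1 : ℝ → ℝ → ℝ}

def Uf (h : ℝ → ℝ → ℝ) (r t : ℝ) : ℝ := (1 / 2) * ∫ σ in (-r)..r, Pk h σ t

lemma KerBd.Pk_glob (hκ : 1 < κ) (H : KerBd κ A k) (r t : ℝ) : |Pk k r t| ≤ A * Jap κ := by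
  have hA := H.A_nonneg
  rw [← Real.norm_eq_abs, ← Jap_shift κ r, ← integral_const_mul]
  refine (norm_integral_le_of_norm_le ((jap_shift hκ r).const_mul A).integrableOn
    (Filter.Eventually.of_forall fun τ => H.b0 _ _)).trans ?_
  exact setIntegral_le_integral ((jap_shift hκ r).const_mul A)
    (Filter.Eventually.of_forall fun τ => by simp only [Pi.zero_apply]; positivity)

lemma Pk_cr (hκ : 1 < κ) (H : KerBd κ A k) (t : ℝ) : Continuous (fun r => Pk k r t) :=
  (H.Pk_cont hκ).comp (f := fun r : ℝ => (r, t)) (by fun_prop)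

lemma Uf_deriv_r (hκ : 1 < κ) (H : KerBd κ A h) (r t : ℝ) :
    HasDerivAt (fun r => Uf h r t) ((Pk h r t + Pk h (-r) t) / 2) r := by
  have c := Pk_cr hκ H t
  have e : (fun r => Uf h r t) = fun r => (1 / 2) * ((∫ σ in (0:ℝ)..r, Pk h σ t) -
      ∫ σ in (0:ℝ)..(-r), Pk h σ t) := by
    ext r
    unfold Uf
    rw [intervalIntegral.integral_interval_sub_left (c.intervalIntegrable _ _)
      (c.intervalIntegrable _ _)]
  rw [e]
  have d1 := (c.integral_hasStrictDerivAt 0 r).hasDerivAt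
  have d2 := (c.integral_hasStrictDerivAt 0 (-r)).hasDerivAt.comp r (hasDerivAt_neg r)
  have := (d1.sub d2).const_mul (1 / 2 : ℝ)
  convert! this using 1
  ring

lemma odd_int (hodd : ∀ l s, h (-l) s = -h l s) (r t : ℝ) :
    ∫ σ in (-r)..r, h σ t = 0 := by
  have h1 := intervalIntegral.integral_comp_neg (a := -r) (b := r) (fun σ => h σ t)
  simp only [hodd, intervalIntegral.integral_neg, neg_neg] at h1
  linarith

lemma Uf_deriv_t (hκ : 1 < κ) (H : KerBd κ A h) (H1 : KerBd κ A h1)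
    (hd : ∀ l s, HasDerivAt (fun l => h l s) (h1 l s) l) (hodd : ∀ l s, h (-l) s = -h l s)
    (r t : ℝ) :
    HasDerivAt (fun t => Uf h r t) ((Pk h (-r) t - Pk h r t) / 2) t := by
  have hA := H.A_nonneg
  have ch : Continuous (fun σ => h σ t) := H.cont.comp (f := fun r : ℝ => (r, t)) (by fun_prop)
  have cP := Pk_cr hκ H1 t
  have key := (intervalIntegral.hasDerivAt_integral_of_dominated_loc_of_deriv_le
    (μ := volume) (a := -r) (b := r) (x₀ := t) (s := Set.univ)
    (F := fun t σ => Pk h σ t) (F' := fun t σ => -h σ t - Pk h1 σ t)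
    (bound := fun _ => A + A * Jap κ) Filter.univ_mem
    (Filter.Eventually.of_forall fun x => (Pk_cr hκ H x).aestronglyMeasurable)
    ((Pk_cr hκ H t).intervalIntegrable _ _)
    (ch.neg.sub cP).aestronglyMeasurable
    (Filter.Eventually.of_forall fun σ _ x _ => by
      have h3 := H1.Pk_glob hκ σ x
      have h2 : |h σ x| ≤ A := by
        refine (H.b0 σ x).trans (mul_le_of_le_one_right hA ?_)
        exact Real.rpow_le_one_of_one_le_of_nonpos (by simp) (by linarith)
      calc ‖-h σ x - Pk h1 σ x‖ ≤ ‖-h σ x‖ + ‖Pk h1 σ x‖ := norm_sub_le _ _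
        _ ≤ _ := by rw [norm_neg]; exact add_le_add h2 h3)
    (intervalIntegrable_const)
    (Filter.Eventually.of_forall fun σ _ x _ => Pk_deriv_t hκ H H1 hd σ x)).2
  have e : ∫ σ in (-r)..r, (-h σ t - Pk h1 σ t) = Pk h (-r) t - Pk h r t := by
    have cn : Continuous (fun σ => -h σ t) := ch.neg
    rw [intervalIntegral.integral_sub (cn.intervalIntegrable _ _) (cP.intervalIntegrable _ _),
      intervalIntegral.integral_neg, odd_int hodd,
      intervalIntegral.integral_eq_sub_of_hasDerivAt
        (fun x _ => Pk_deriv_r hκ H H1 hd x t) (cP.intervalIntegrable _ _)]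
    ring
  rw [e] at key
  have := key.const_mul (1 / 2 : ℝ)
  convert! this using 1
  ring

lemma Uf_char (hκ : 1 < κ) (H : KerBd κ A h) (H1 : KerBd κ A h1)
    (hd : ∀ l s, HasDerivAt (fun l => h l s) (h1 l s) l) (hodd : ∀ l s, h (-l) s = -h l s)
    (c σ : ℝ) :
    HasDerivAt (fun σ => Uf h σ (c - σ)) (Pk h σ (c - σ)) σ := by
  have cP := H.Pk_cont hκ
  have cm : Continuous (fun z : ℝ × ℝ => Pk h (-z.1) z.2) :=
    cP.comp (f := fun z : ℝ × ℝ => (-z.1, z.2)) (by fun_prop)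
  have := chain_partials (f := Uf h) (fx := fun r t => (Pk h r t + Pk h (-r) t) / 2)
    (ft := fun r t => (Pk h (-r) t - Pk h r t) / 2)
    (fun r t => Uf_deriv_r hκ H r t) (fun r t => Uf_deriv_t hκ H H1 hd hodd r t)
    ((cP.add cm).div_const 2) ((cm.sub cP).div_const 2)
    (a := fun s => s) (b := fun s => c - s) (s := σ) (hasDerivAt_id σ)
    ((hasDerivAt_id σ).const_sub c)
  convert this using 1
  ring

lemma Uf_zero (t : ℝ) : Uf h 0 t = 0 := by simp [Uf]

lemma Uf_bound (hκ : 1 < κ) (H : KerBd κ A h) (H1 : KerBd κ A h1)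
    (hd : ∀ l s, HasDerivAt (fun l => h l s) (h1 l s) l) (hodd : ∀ l s, h (-l) s = -h l s)
    {r t : ℝ} (hr : 0 < r) (ht : 0 ≤ t) :
    |Uf h r t| ≤ 2 * (1 + Jap 2) * (Cb κ * A * Tw κ r t) * r := by
  obtain ⟨c1, c2, c3⟩ := Cb_parts hκ
  have hA := H.A_nonneg
  have hC : 0 ≤ Cb κ := by unfold Cb; linarith
  have hJ := Jap_nonneg 2
  have hC1 : 2 ^ (κ - 1) / (κ - 1) ≤ Cb κ := by unfold Cb; linarith
  set c := r + t with hc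
  have hP : ∀ σ, 0 ≤ σ → σ ≤ r → |Pk h σ (c - σ)| ≤
      Cb κ * A * (1 + r + t) ^ (-(κ - 1)) * (1 + |2 * σ - c|) ^ (-(2:ℝ)) := by
    intro σ h0 h1
    have := H.Pk_pos hκ h0 (show 0 ≤ c - σ by linarith)
    rw [show 1 + σ + (c - σ) = 1 + r + t by rw [hc]; ring,
      show σ - (c - σ) = 2 * σ - c by ring] at this
    refine this.trans ?_
    rw [mul_assoc, mul_assoc, mul_assoc]
    gcongr
  have hd1 := fun σ => Uf_char hκ H H1 hd hodd c σ
  have hz : Uf h 0 (c - 0) = 0 := Uf_zero _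
  have hpos : 0 < 1 + |r - t| := by positivity
  by_cases hcase : r ≤ t ∨ r ≤ 1
  · have hb : ∀ σ ∈ Icc 0 r, ‖Pk h σ (c - σ)‖ ≤
        Cb κ * A * (1 + r + t) ^ (-(κ - 1)) * (2 * (1 + |r - t|)⁻¹) := by
      intro σ hσ
      refine (hP σ hσ.1 hσ.2).trans ?_
      refine mul_le_mul_of_nonneg_left ?_ (by positivity)
      rcases le_or_gt r t with hrt | hrt
      · have h1 : 1 + |r - t| ≤ 1 + |2 * σ - c| := by
          rw [abs_of_nonpos (by linarith : r - t ≤ 0)]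
          have := neg_abs_le (2 * σ - c)
          linarith [hσ.2]
        refine (sq_le_inv (by simp)).trans ((inv_anti₀ hpos h1).trans ?_)
        have : 0 ≤ (1 + |r - t|)⁻¹ := by positivity
        linarith
      · have hr1 : r ≤ 1 := by rcases hcase with h | h; linarith; exact h
        have h1 : (1 + |2 * σ - c|) ^ (-(2:ℝ)) ≤ 1 :=
          Real.rpow_le_one_of_one_le_of_nonpos (by simp) (by norm_num)
        refine h1.trans ?_
        rw [← div_eq_mul_inv, le_div_iff₀ hpos, abs_of_pos (by linarith)]
        linarith
    have := (convex_Icc (0:ℝ) r).norm_image_sub_le_of_norm_hasDerivWithin_le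
      (fun σ _ => (hd1 σ).hasDerivWithinAt) hb (left_mem_Icc.2 hr.le) (right_mem_Icc.2 hr.le)
    rw [hz] at this
    simp only [sub_zero, Real.norm_eq_abs] at this
    rw [show c - r = t by rw [hc]; ring, abs_of_pos hr] at this
    refine this.trans ?_
    refine mul_le_mul_of_nonneg_right ?_ hr.le
    unfold Tw
    have h2 : 0 ≤ Cb κ * A * ((1 + r + t) ^ (-(κ - 1)) * (1 + |r - t|)⁻¹) := by positivity
    nlinarith [mul_nonneg hJ h2]
  · push Not at hcase
    obtain ⟨htr, hr1⟩ := hcase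
    have cc : Continuous (fun σ => Pk h σ (c - σ)) :=
      (H.Pk_cont hκ).comp (f := fun σ : ℝ => (σ, c - σ)) (by fun_prop)
    have e := intervalIntegral.integral_eq_sub_of_hasDerivAt (a := 0) (b := r)
      (fun x _ => hd1 x) (cc.intervalIntegrable _ _)
    rw [hz, sub_zero, show c - r = t by rw [hc]; ring] at e
    rw [← e, intervalIntegral.integral_of_le hr.le, ← Real.norm_eq_abs]
    set D := Cb κ * A * (1 + r + t) ^ (-(κ - 1)) with hD
    have D0 : 0 ≤ D := by positivity
    have hj := (jap_shift (κ := 2) (by norm_num) (-(c / 2))).const_mul D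
    have s1 : ‖∫ σ in Ioc 0 r, Pk h σ (c - σ)‖ ≤
        ∫ σ in Ioc 0 r, D * (1 + |σ + -(c / 2)|) ^ (-(2:ℝ)) := by
      refine norm_integral_le_of_norm_le hj.integrableOn ?_
      refine (ae_restrict_iff' measurableSet_Ioc).2 (Filter.Eventually.of_forall fun σ hσ => ?_)
      refine (hP σ hσ.1.le hσ.2).trans ?_
      refine mul_le_mul_of_nonneg_left ?_ D0
      refine Real.rpow_le_rpow_of_nonpos (by positivity) ?_ (by norm_num)
      rw [show 2 * σ - c = 2 * (σ + -(c / 2)) by ring, abs_mul]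
      have := abs_nonneg (σ + -(c / 2))
      norm_num
      linarith
    have s2 : (∫ σ in Ioc 0 r, D * (1 + |σ + -(c / 2)|) ^ (-(2:ℝ))) ≤
        ∫ σ : ℝ, D * (1 + |σ + -(c / 2)|) ^ (-(2:ℝ)) :=
      setIntegral_le_integral hj
        (Filter.Eventually.of_forall fun τ => by simp only [Pi.zero_apply]; positivity)
    have s3 : ∫ σ : ℝ, D * (1 + |σ + -(c / 2)|) ^ (-(2:ℝ)) = D * Jap 2 := by
      rw [integral_const_mul, Jap_shift]
    rw [s3] at s2
    refine (s1.trans s2).trans ?_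
    have h3 : 1 ≤ 2 * (1 + |r - t|)⁻¹ * r := by
      rw [mul_assoc, mul_comm _ r, ← mul_assoc, ← div_eq_mul_inv, le_div_iff₀ hpos,
        abs_of_pos (by linarith)]
      linarith
    calc D * Jap 2 ≤ D * (1 + Jap 2) * 1 := by nlinarith
      _ ≤ D * (1 + Jap 2) * (2 * (1 + |r - t|)⁻¹ * r) :=
        mul_le_mul_of_nonneg_left h3 (by positivity)
      _ = _ := by unfold Tw; rw [hD]; ring

lemma Rop_eq (hκ : 1 < κ) (H : KerBd κ A h) {F : ℝ → ℝ → ℝ}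
    (hF : ∀ l s, 0 < s → l * F l s = h l s) {r t : ℝ} (ht : 0 ≤ t) :
    Rop F r t = Uf h r t / r := by
  have hA := H.A_nonneg
  have e1 : ∫ s in Ioi t, (∫ l in ((s - t) - r)..((s - t) + r), l * F l s) =
      ∫ s in Ioi t, ∫ σ in (-r)..r, h (s - t + σ) s := by
    refine setIntegral_congr_fun measurableSet_Ioi fun s hs => ?_
    have hs : t < s := hs
    simp only [hF _ s (lt_of_le_of_lt ht hs)]
    rw [intervalIntegral.integral_comp_add_left (fun l => h l s) (s - t)]
    rw [← sub_eq_add_neg]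
  have e2 : ∫ s in Ioi t, ∫ σ in (-r)..r, h (s - t + σ) s = ∫ σ in (-r)..r, Pk h σ t := by
    simp only [Pk_eq]
    refine (intervalIntegral_integral_swap (f := fun σ s => h (s - t + σ) s) ?_).symm
    haveI : IsFiniteMeasure (volume.restrict (uIoc (-r) r)) := by
      unfold uIoc; infer_instance
    have hb : Integrable (fun z : ℝ × ℝ => A * ((1 + |r|) ^ κ * (1 + |z.2 + -t|) ^ (-κ)))
        ((volume.restrict (Set.uIoc (-r) r)).prod (volume.restrict (Ioi t))) :=
      Integrable.comp_snd (f := fun s : ℝ => A * ((1 + |r|) ^ κ * (1 + |s + -t|) ^ (-κ)))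
        (((jap_shift hκ (-t)).const_mul _).const_mul A).integrableOn _
    refine hb.mono' ?_ ?_
    · exact (H.cont.comp (f := fun z : ℝ × ℝ => (z.2 - t + z.1, z.2))
        (by fun_prop)).aestronglyMeasurable
    · rw [Measure.prod_restrict]
      refine (ae_restrict_iff' (measurableSet_uIoc.prod measurableSet_Ioi)).2
        (Filter.Eventually.of_forall fun z hz => ?_)
      refine (H.b0 _ _).trans (mul_le_mul_of_nonneg_left ?_ hA)
      refine jap_cmp (by linarith) (abs_nonneg r) ?_
      rw [show z.2 + -t - (z.2 - t + z.1) = -z.1 by ring, abs_neg]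
      have := hz.1
      rw [Set.mem_uIoc] at this
      rcases this with h | h
      · exact abs_le_abs h.2 (by linarith [h.1])
      · rw [abs_of_nonpos (show r ≤ 0 by linarith)]
        exact abs_le.2 ⟨by linarith, by linarith⟩
  unfold Rop Uf
  rw [e1, e2]
  by_cases hr : r = 0
  · simp [hr]
  · field_simp
end


lemma deriv_eq_of_freq {f g : ℝ → ℝ} {f' g' x : ℝ} (hf : HasDerivAt f f' x)
    (hg : HasDerivAt g g' x) (h : ∃ᶠ z in 𝓝[≠] x, f z = g z) : f' = g' := by
  by_contra hne
  have := (hf.sub hg).eventually_ne (c := 0) (sub_ne_zero.2 hne)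
  obtain ⟨z, h1, h2⟩ := (h.and_eventually this).exists
  exact h2 (by simp [h1])

lemma junk_deriv {G h : ℝ → ℝ} {r G' : ℝ} (hG : HasDerivAt G G' r)
    (hh : ∀ᶠ x in 𝓝 r, h x = 0 ∨ h x = G x) : |deriv h r| ≤ |G'| := by
  by_cases hd : DifferentiableAt ℝ h r
  · by_cases hf : ∃ᶠ z in 𝓝[≠] r, h z = G z
    · rw [deriv_eq_of_freq hd.hasDerivAt hG hf]
    · rw [Filter.not_frequently] at hf
      have h0 : ∀ᶠ z in 𝓝[≠] r, h z = 0 := by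
        filter_upwards [hf, hh.filter_mono nhdsWithin_le_nhds] with z h1 h2
        exact h2.resolve_right h1
      rw [deriv_eq_of_freq hd.hasDerivAt (hasDerivAt_const r (0:ℝ)) h0.frequently]
      simp
  · rw [deriv_zero_of_not_differentiableAt hd]; simp

lemma time_pos {f g : ℝ → ℝ} {g' t : ℝ} (hg : HasDerivAt g g' t) (ht : 0 < t)
    (h : ∀ s, 0 < s → f s = g s) : deriv f t = g' := by
  have : f =ᶠ[𝓝 t] g := by
    filter_upwards [lt_mem_nhds ht] with s hs using h s hs
  rw [this.deriv_eq, hg.deriv]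

lemma time_junk {f g : ℝ → ℝ} {g' t : ℝ} (hg : HasDerivAt g g' t) (ht : 0 ≤ t)
    (h : ∀ s, 0 < s → f s = g s) : deriv f t = 0 ∨ deriv f t = g' := by
  by_cases hd : DifferentiableAt ℝ f t
  · right
    refine deriv_eq_of_freq hd.hasDerivAt hg ?_
    have h1 : ∀ᶠ s in 𝓝[>] t, f s = g s := by
      filter_upwards [self_mem_nhdsWithin] with s hs
      exact h s (lt_of_le_of_lt ht hs)
    exact h1.frequently.filter_mono (nhdsWithin_mono t fun s hs => ne_of_gt hs)
  · left
    exact deriv_zero_of_not_differentiableAt hd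

lemma abs_of_or {x y : ℝ} (h : x = 0 ∨ x = y) : |x| ≤ |y| := by
  rcases h with h | h <;> simp [h]

lemma bracket_junk {R S Sr St Srr Srt Stt : ℝ → ℝ → ℝ}
    (hRS : ∀ r t, 0 < r → 0 ≤ t → R r t = S r t)
    (d1 : ∀ r t, 0 < r → HasDerivAt (fun r => S r t) (Sr r t) r)
    (d2 : ∀ r t, 0 < r → HasDerivAt (fun t => S r t) (St r t) t)
    (d3 : ∀ r t, 0 < r → HasDerivAt (fun r => Sr r t) (Srr r t) r)
    (d4 : ∀ r t, 0 < r → HasDerivAt (fun r => St r t) (Srt r t) r)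
    (d5 : ∀ r t, 0 < r → HasDerivAt (fun t => St r t) (Stt r t) t)
    {r t : ℝ} (hr : 0 < r) (ht : 0 ≤ t) :
    bracket2 R r t ≤ |S r t| + (1 + r) * (|Sr r t| + |St r t|) +
      r * (|Srr r t| + |Srt r t| + |Stt r t|) := by
  have e1 : ∀ r t, 0 < r → 0 ≤ t → pdr R r t = Sr r t := by
    intro r t hr ht
    exact time_pos (d1 r t hr) hr fun s hs => hRS s t hs ht
  have e2 : ∀ r t, 0 < r → 0 < t → pdt R r t = St r t := by
    intro r t hr ht
    exact time_pos (d2 r t hr) ht fun s hs => hRS r s hr hs.le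
  have e2' : ∀ r t, 0 < r → 0 ≤ t → pdt R r t = 0 ∨ pdt R r t = St r t := by
    intro r t hr ht
    exact time_junk (d2 r t hr) ht fun s hs => hRS r s hr hs.le
  have e3 : pdr (pdr R) r t = Srr r t :=
    time_pos (d3 r t hr) hr fun s hs => e1 s t hs ht
  have e4 : |pdr (pdt R) r t| ≤ |Srt r t| := by
    refine junk_deriv (d4 r t hr) ?_
    filter_upwards [lt_mem_nhds hr] with x hx using e2' x t hx ht
  have e5 : |pdt (pdt R) r t| ≤ |Stt r t| :=
    abs_of_or (time_junk (d5 r t hr) ht fun s hs => e2 r s hr hs)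
  have e6 := abs_of_or (e2' r t hr ht)
  unfold bracket2
  rw [hRS r t hr ht, e1 r t hr ht, e3]
  gcongr

section
variable {κ A : ℝ} {h h1 : ℝ → ℝ → ℝ}

def CR (κ : ℝ) : ℝ := (5 * (2 * (1 + Jap 2)) + 15 + 7 * 2 ^ κ) * Cb κ

lemma linear_bound (hκ : 1 < κ) (H : KerBd κ A h) (H1 : KerBd κ A h1)
    (hd : ∀ l s, HasDerivAt (fun l => h l s) (h1 l s) l) (hodd : ∀ l s, h (-l) s = -h l s)
    {F : ℝ → ℝ → ℝ} (hF : ∀ l s, 0 < s → l * F l s = h l s)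
    {r t : ℝ} (hr : 0 < r) (ht : 0 ≤ t) :
    bracket2 (Rop F) r t ≤ CR κ * A * Tw κ r t := by
  have dP := Pk_deriv_r hκ H H1 hd
  have dPn : ∀ r t, HasDerivAt (fun r => Pk h (-r) t) (-Pk h1 (-r) t) r := fun r t => by
    have := (dP (-r) t).comp r (hasDerivAt_neg r)
    convert! this using 1
    ring
  have dPt := Pk_deriv_t hκ H H1 hd
  have dUr : ∀ r t, HasDerivAt (fun r => Uf h r t) ((Pk h r t + Pk h (-r) t) / 2) r :=
    fun r t => Uf_deriv_r hκ H r t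
  have dUt : ∀ r t, HasDerivAt (fun t => Uf h r t) ((Pk h (-r) t - Pk h r t) / 2) t :=
    fun r t => Uf_deriv_t hκ H H1 hd hodd r t
  have dUrr : ∀ r t, HasDerivAt (fun r => (Pk h r t + Pk h (-r) t) / 2)
      ((Pk h1 r t - Pk h1 (-r) t) / 2) r := fun r t => by
    have := ((dP r t).add (dPn r t)).div_const 2
    convert! this using 1
  have dUtr : ∀ r t, HasDerivAt (fun r => (Pk h (-r) t - Pk h r t) / 2)
      (-(Pk h1 r t + Pk h1 (-r) t) / 2) r := fun r t => by
    have := ((dPn r t).sub (dP r t)).div_const 2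
    convert! this using 1
    ring
  have dUtt : ∀ r t, HasDerivAt (fun t => (Pk h (-r) t - Pk h r t) / 2)
      (h r t + (Pk h1 r t - Pk h1 (-r) t) / 2) t := fun r t => by
    have := ((dPt (-r) t).sub (dPt r t)).div_const 2
    convert! this using 1
    rw [hodd]; ring
  set U := Uf h with hU
  set Ur : ℝ → ℝ → ℝ := fun r t => (Pk h r t + Pk h (-r) t) / 2 with hUr
  set Ut : ℝ → ℝ → ℝ := fun r t => (Pk h (-r) t - Pk h r t) / 2 with hUt
  set Urr : ℝ → ℝ → ℝ := fun r t => (Pk h1 r t - Pk h1 (-r) t) / 2 with hUrr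
  set Utr : ℝ → ℝ → ℝ := fun r t => -(Pk h1 r t + Pk h1 (-r) t) / 2 with hUtr
  set Utt : ℝ → ℝ → ℝ := fun r t => h r t + (Pk h1 r t - Pk h1 (-r) t) / 2 with hUtt
  have main := bracket_junk (R := Rop F) (S := fun r t => U r t / r)
    (Sr := fun r t => Ur r t / r - U r t / r ^ 2) (St := fun r t => Ut r t / r)
    (Srr := fun r t => Urr r t / r - 2 * (Ur r t / r ^ 2) + 2 * (U r t / r ^ 3))
    (Srt := fun r t => Utr r t / r - Ut r t / r ^ 2)
    (Stt := fun r t => Utt r t / r)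
    (fun r t hr ht => Rop_eq hκ H hF ht)
    (fun r t hr => by
      have := (dUr r t).div (hasDerivAt_id r) hr.ne'
      convert! this using 1
      simp only [hUr, id]
      field_simp)
    (fun r t hr => (dUt r t).div_const r)
    (fun r t hr => by
      have := ((dUrr r t).div (hasDerivAt_id r) hr.ne').sub
        ((dUr r t).div (hasDerivAt_pow 2 r) (by positivity))
      convert! this using 1
      simp only [hUr, hUrr, id]
      field_simp
      ring)
    (fun r t hr => by
      have := (dUtr r t).div (hasDerivAt_id r) hr.ne'
      convert! this using 1
      simp only [hUtr, hUt, id]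
      field_simp)
    (fun r t hr => (dUtt r t).div_const r) hr ht
  refine main.trans ?_
  clear main
  obtain ⟨c1, c2, c3⟩ := Cb_parts hκ
  have hA := H.A_nonneg
  have hC : 0 ≤ Cb κ := by unfold Cb; linarith
  have hJ := Jap_nonneg 2
  have bX : ∀ r, 0 ≤ r → |Ur r t| ≤ Cb κ * A * Tw κ r t ∧ |Ut r t| ≤ Cb κ * A * Tw κ r t ∧
      |Urr r t| ≤ Cb κ * A * Tw κ r t ∧ |Utr r t| ≤ Cb κ * A * Tw κ r t ∧
      |Utt r t| ≤ 2 * (Cb κ * A * Tw κ r t) := by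
    intro r hr
    have a1 := abs_le.1 (H.Pk_pos' hκ hr ht)
    have a2 := abs_le.1 (H.Pk_neg' hκ hr ht)
    have a3 := abs_le.1 (H1.Pk_pos' hκ hr ht)
    have a4 := abs_le.1 (H1.Pk_neg' hκ hr ht)
    have a5 := abs_le.1 (H.ker' hκ hr ht)
    simp only [hUr, hUt, hUrr, hUtr, hUtt]
    refine ⟨abs_le.2 ⟨?_, ?_⟩, abs_le.2 ⟨?_, ?_⟩, abs_le.2 ⟨?_, ?_⟩, abs_le.2 ⟨?_, ?_⟩,
      abs_le.2 ⟨?_, ?_⟩⟩ <;> linarith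
  have hT := Tw_pos (κ := κ) hr.le ht
  set X := Cb κ * A * Tw κ r t with hX
  have X0 : 0 ≤ X := by positivity
  set M := 2 * (1 + Jap 2) with hM
  have M0 : 0 ≤ M := by positivity
  obtain ⟨b1, b2, b3, b4, b5⟩ := bX r hr.le
  have bU : |U r t| ≤ M * X * r := Uf_bound hκ H H1 hd hodd hr ht
  have bR : |U r t / r| ≤ M * X := by
    rw [abs_div, abs_of_pos hr, div_le_iff₀ hr]; exact bU
  have hgoal : CR κ * A * Tw κ r t = (5 * M + 15 + 7 * 2 ^ κ) * X := by
    unfold CR; rw [hX, hM]; ring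
  rw [hgoal]
  set Y := (2:ℝ) ^ κ * X with hY
  have Y0 : 0 ≤ Y := by positivity
  have f5 : r * |Utt r t / r| ≤ 2 * X := by
    rw [abs_div, abs_of_pos hr, mul_div_cancel₀ _ hr.ne']; exact b5
  have g3 : r * |Urr r t / r - 2 * (Ur r t / r ^ 2) + 2 * (U r t / r ^ 3)| =
      |Urr r t - 2 * (Ur r t / r - U r t / r ^ 2)| := by
    nth_rewrite 1 [← abs_of_pos hr]
    rw [← abs_mul]; congr 1; field_simp; ring
  have g4 : r * |Utr r t / r - Ut r t / r ^ 2| = |Utr r t - Ut r t / r| := by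
    nth_rewrite 1 [← abs_of_pos hr]
    rw [← abs_mul]; congr 1; field_simp
  rw [mul_add, mul_add, mul_add, g3, g4]
  have t3 : |Urr r t - 2 * (Ur r t / r - U r t / r ^ 2)| ≤
      X + 2 * |Ur r t / r - U r t / r ^ 2| := by
    refine (abs_sub _ _).trans ?_
    rw [abs_mul, abs_of_pos (by norm_num : (0:ℝ) < 2)]
    linarith
  have t4 : |Utr r t - Ut r t / r| ≤ X + |Ut r t / r| := by
    refine (abs_sub _ _).trans ?_
    linarith
  rcases le_or_gt 1 r with h1r | h1r
  · have f1 : r * |Ur r t / r - U r t / r ^ 2| ≤ (1 + M) * X := by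
      nth_rewrite 1 [← abs_of_pos hr]
      rw [← abs_mul]
      have : r * (Ur r t / r - U r t / r ^ 2) = Ur r t - U r t / r := by field_simp
      rw [this]
      refine (abs_sub _ _).trans ?_
      linarith
    have f2 : r * |Ut r t / r| ≤ X := by
      rw [abs_div, abs_of_pos hr, mul_div_cancel₀ _ hr.ne']; exact b2
    have n1 := abs_nonneg (Ur r t / r - U r t / r ^ 2)
    have n2 := abs_nonneg (Ut r t / r)
    nlinarith
  · have hcmp : ∀ σ ∈ Icc 0 r, Cb κ * A * Tw κ σ t ≤ Y := by
      intro σ hσ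
      have := Tw_cmp hκ hσ.1 hσ.2 h1r.le ht
      calc _ ≤ Cb κ * A * (2 ^ κ * Tw κ r t) := by gcongr
        _ = Y := by rw [hY, hX]; ring
    have f1 : |Ur r t / r - U r t / r ^ 2| ≤ Y := by
      have hder : ∀ σ, HasDerivAt (fun σ => σ * Ur σ t - U σ t) (σ * Urr σ t) σ := by
        intro σ
        have := ((hasDerivAt_id σ).mul (dUrr σ t)).sub (dUr σ t)
        convert! this using 1
        simp [hUrr, hUr]
      have hb : ∀ σ ∈ Icc 0 r, ‖σ * Urr σ t‖ ≤ r * Y := by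
        intro σ hσ
        rw [norm_mul, Real.norm_eq_abs, Real.norm_eq_abs, abs_of_nonneg hσ.1]
        exact mul_le_mul hσ.2 ((bX σ hσ.1).2.2.1.trans (hcmp σ hσ)) (abs_nonneg _) hr.le
      have := (convex_Icc (0:ℝ) r).norm_image_sub_le_of_norm_hasDerivWithin_le
        (fun σ _ => (hder σ).hasDerivWithinAt) hb (left_mem_Icc.2 hr.le) (right_mem_Icc.2 hr.le)
      rw [show U 0 t = 0 from Uf_zero t] at this
      simp only [zero_mul, sub_zero, Real.norm_eq_abs] at this
      rw [abs_of_pos hr] at this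
      have e : Ur r t / r - U r t / r ^ 2 = (r * Ur r t - U r t) / r ^ 2 := by field_simp
      rw [e, abs_div, abs_of_pos (by positivity : 0 < r ^ 2), div_le_iff₀ (by positivity)]
      linarith
    have f2 : |Ut r t / r| ≤ Y := by
      have hb : ∀ σ ∈ Icc 0 r, ‖Utr σ t‖ ≤ Y := fun σ hσ =>
        (bX σ hσ.1).2.2.2.1.trans (hcmp σ hσ)
      have := (convex_Icc (0:ℝ) r).norm_image_sub_le_of_norm_hasDerivWithin_le
        (fun σ _ => (dUtr σ t).hasDerivWithinAt) hb (left_mem_Icc.2 hr.le)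
        (right_mem_Icc.2 hr.le)
      have e : (Pk h (-0) t - Pk h 0 t) / 2 = 0 := by simp
      rw [e] at this
      simp only [sub_zero, Real.norm_eq_abs] at this
      rw [abs_of_pos hr] at this
      rw [abs_div, abs_of_pos hr, div_le_iff₀ hr]
      exact this
    have n1 := abs_nonneg (Ur r t / r - U r t / r ^ 2)
    have n2 := abs_nonneg (Ut r t / r)
    nlinarith
end


section Nonlinear

/-- Regularized time derivative of a function in `X²`. -/
structure RegW (w g1 : ℝ → ℝ → ℝ) : Prop where
  cw : Continuous (fun z : ℝ × ℝ => w z.1 z.2)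
  cg : Continuous (fun z : ℝ × ℝ => g1 z.1 z.2)
  hd : ∀ r t, HasDerivAt (fun r => r * w r t) (g1 r t) r
  even : ∀ r t, w (-r) t = w r t
  mw : ∀ r t, w r t = w r (max t 0)
  mg : ∀ r t, g1 r t = g1 r (max t 0)

lemma memX_reg {u : ℝ → ℝ → ℝ} (hu : memX 2 u) :
    ∃ w g1 : ℝ → ℝ → ℝ, RegW w g1 ∧ ∀ r t, 0 < t → HasDerivAt (fun t' => u r t') (w r t) t := by
  obtain ⟨h1, h2, hev⟩ := hu
  set S : Set (ℝ × ℝ) := Set.univ ×ˢ Set.Ici (0:ℝ) with hSdef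
  have hS : UniqueDiffOn ℝ S := uniqueDiffOn_univ.prod (uniqueDiffOn_Ici 0)
  set U : ℝ × ℝ → ℝ := fun z => u z.1 z.2 with hU
  set V : ℝ × ℝ → ℝ := fun z => z.1 * u z.1 z.2 with hV
  have h1' : ContDiffOn ℝ 1 U S := by simpa using h1
  have h2' : ContDiffOn ℝ 2 V S := by simpa using h2
  have cU : ContinuousOn (fderivWithin ℝ U S) S := h1'.continuousOn_fderivWithin hS le_rfl
  have cV : ContDiffOn ℝ 1 (fderivWithin ℝ V S) S := h2'.fderivWithin hS (by norm_num)
  set G : ℝ × ℝ → ℝ := fun z => fderivWithin ℝ V S z (0, 1) with hG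
  have cG : ContDiffOn ℝ 1 G S := cV.clm_apply contDiffOn_const
  have cG1 : ContinuousOn (fderivWithin ℝ G S) S := cG.continuousOn_fderivWithin hS le_rfl
  have hP : ∀ z : ℝ × ℝ, (z.1, max z.2 0) ∈ S := fun z => ⟨mem_univ _, mem_Ici.2 (le_max_right _ _)⟩
  have cP : Continuous (fun z : ℝ × ℝ => (z.1, max z.2 0)) := by fun_prop
  have dU : DifferentiableOn ℝ U S := h1'.differentiableOn (by norm_num)
  have dG : DifferentiableOn ℝ G S := cG.differentiableOn (by norm_num)
  have hGw : ∀ z ∈ S, G z = z.1 * fderivWithin ℝ U S z (0, 1) := by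
    intro z hz
    have e1 : HasFDerivWithinAt U (fderivWithin ℝ U S z) S z := (dU z hz).hasFDerivWithinAt
    have e2 : HasFDerivWithinAt (fun z : ℝ × ℝ => z.1) (ContinuousLinearMap.fst ℝ ℝ ℝ) S z :=
      hasFDerivWithinAt_fst
    have e3 := (e2.mul e1).fderivWithin (hS z hz)
    have e4 : fderivWithin ℝ V S z = _ := e3
    simp only [hG, e4]
    simp
  set w : ℝ → ℝ → ℝ := fun r t => fderivWithin ℝ U S (r, max t 0) (0, 1) with hw
  set g1 : ℝ → ℝ → ℝ := fun r t => fderivWithin ℝ G S (r, max t 0) (1, 0) with hg1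
  have cw : Continuous (fun z : ℝ × ℝ => w z.1 z.2) :=
    (cU.comp_continuous cP hP).clm_apply continuous_const
  have cg : Continuous (fun z : ℝ × ℝ => g1 z.1 z.2) :=
    (cG1.comp_continuous cP hP).clm_apply continuous_const
  have wder : ∀ r t, 0 < t → HasDerivAt (fun t' => u r t') (w r t) t := by
    intro r t ht
    have hz : ((r, t) : ℝ × ℝ) ∈ S := ⟨mem_univ _, ht.le⟩
    have hn : S ∈ 𝓝 ((r, t) : ℝ × ℝ) := prod_mem_nhds univ_mem (Ici_mem_nhds ht)
    have e1 : HasFDerivAt U (fderivWithin ℝ U S (r, t)) (r, t) :=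
      ((dU _ hz).hasFDerivWithinAt).hasFDerivAt hn
    have e2 : HasDerivAt (fun t' : ℝ => ((r, t') : ℝ × ℝ)) (0, 1) t :=
      (hasDerivAt_const t r).prodMk (hasDerivAt_id t)
    have e3 := e1.comp_hasDerivAt t e2
    have e4 : HasDerivAt (fun t' => u r t') _ t := e3
    refine e4.congr_deriv ?_
    simp only [hw, max_eq_left ht.le]
  have wpos : ∀ r t, 0 < t → w r t = pdt u r t := fun r t ht => (wder r t ht).deriv.symm
  have wmax : ∀ r t, w r t = w r (max t 0) := by
    intro r t; simp [hw]
  refine ⟨w, g1, ⟨cw, cg, ?_, ?_, wmax, ?_⟩, wder⟩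
  · intro r t
    have hz := hP (r, t)
    have e1 : HasFDerivWithinAt G (fderivWithin ℝ G S (r, max t 0)) S (r, max t 0) :=
      (dG _ hz).hasFDerivWithinAt
    have e2 : HasDerivAt (fun r' : ℝ => ((r', max t 0) : ℝ × ℝ)) (1, 0) r :=
      (hasDerivAt_id r).prodMk (hasDerivAt_const r _)
    have e3 := HasFDerivWithinAt.comp_hasDerivWithinAt (s := univ) r e1 e2.hasDerivWithinAt
      (fun x _ => hP (x, t))
    rw [hasDerivWithinAt_univ] at e3
    refine e3.congr_of_eventuallyEq (Eventually.of_forall fun x => ?_)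
    exact (hGw _ (hP (x, t))).symm
  · intro r t
    have hpos : ∀ s, 0 < s → w (-r) s = w r s := by
      intro s hs
      rw [wpos _ _ hs, wpos _ _ hs]
      unfold pdt
      apply Filter.EventuallyEq.deriv_eq
      filter_upwards [Ioi_mem_nhds hs] with x hx
      exact hev r x (le_of_lt hx)
    have hcl : IsClosed {s : ℝ | w (-r) s = w r s} :=
      isClosed_eq (cw.comp (by fun_prop : Continuous fun s : ℝ => ((-r, s) : ℝ × ℝ)))
        (cw.comp (by fun_prop : Continuous fun s : ℝ => ((r, s) : ℝ × ℝ)))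
    have hsub : closure (Ioi (0:ℝ)) ⊆ {s : ℝ | w (-r) s = w r s} :=
      hcl.closure_subset_iff.2 (fun s hs => hpos s hs)
    rw [closure_Ioi] at hsub
    rw [wmax (-r), wmax r]
    exact hsub (le_max_right t 0)
  · intro r t; simp [hg1]

lemma KerBd_ext {κ A : ℝ} (hκ : 0 < κ) {k : ℝ → ℝ → ℝ}
    (hc : Continuous (fun z : ℝ × ℝ => k z.1 z.2)) (hs : ∀ l s, |k (-l) s| = |k l s|)
    (hm : ∀ l s, k l s = k l (max s 0))
    (hb : ∀ l s, 0 < l → 0 < s → |k l s| ≤ A * ((1+l)^(-κ) * (1+|l-s|)^(-(κ+1)))) :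
    KerBd κ A k := by
  have hb' : ∀ l s, 0 ≤ s → |k l s| ≤ A*((1+|l|)^(-κ) * (1+|(|l|-s)|)^(-(κ+1))) := by
    have hcl : IsClosed {z : ℝ × ℝ | |k z.1 z.2| ≤
        A*((1+|z.1|)^(-κ) * (1+|(|z.1|-z.2)|)^(-(κ+1)))} := by
      apply isClosed_le hc.abs
      refine continuous_const.mul (Continuous.mul ?_ ?_)
      · refine Continuous.rpow_const (by fun_prop) (fun z => Or.inl ?_)
        positivity
      · refine Continuous.rpow_const (by fun_prop) (fun z => Or.inl ?_)
        positivity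
    have hsub : (Ioi (0:ℝ)) ×ˢ (Ioi (0:ℝ)) ⊆ {z : ℝ × ℝ | |k z.1 z.2| ≤
        A*((1+|z.1|)^(-κ) * (1+|(|z.1|-z.2)|)^(-(κ+1)))} := by
      rintro ⟨l, s⟩ ⟨hl, hs⟩
      have := hb l s hl hs
      simp only [mem_ofPred_eq]
      rwa [abs_of_pos (show 0 < l from hl)]
    have h2 := hcl.closure_subset_iff.2 hsub
    rw [closure_prod_eq, closure_Ioi] at h2
    intro l s hs0
    have h3 := @h2 (|l|, s) ⟨abs_nonneg l, hs0⟩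
    simp only [mem_ofPred_eq, abs_abs] at h3
    rcases abs_choice l with h | h
    · rw [h] at h3; rw [h]; exact h3
    · have : |k |l| s| = |k l s| := by rw [h, hs]
      rw [this] at h3; exact h3
  refine ⟨hc, ?_, hb'⟩
  intro l s
  rw [hm]
  have h0 := hb' l (max s 0) (le_max_right _ _)
  have hA : 0 ≤ A := by
    have h1 := (abs_nonneg _).trans (hb' 0 0 le_rfl)
    simpa using h1
  refine h0.trans (mul_le_mul_of_nonneg_left ?_ hA)
  have : (1+|(|l|-(max s 0))|)^(-(κ+1)) ≤ 1 :=
    Real.rpow_le_one_of_one_le_of_nonpos (by linarith [abs_nonneg (|l| - max s 0)]) (by linarith)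
  have h2 : 0 ≤ (1+|l|)^(-κ) := by positivity
  nlinarith

lemma nonlin_ker {m B : ℝ} (hm : 2 < m) (hB : 0 ≤ B) {w g1 : ℝ → ℝ → ℝ} (R : RegW w g1)
    (b1 : ∀ l s, 0 < l → 0 < s → |w l s| ≤ B * ((1+l)⁻¹ * (1+|l-s|)⁻¹))
    (b2 : ∀ l s, 0 < l → 0 < s → |g1 l s - w l s| ≤ B * (1+|l-s|)⁻¹) :
    ∃ h h1 : ℝ → ℝ → ℝ, KerBd (m-1) ((m+1) * B^m) h ∧ KerBd (m-1) ((m+1) * B^m) h1 ∧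
      (∀ l s, HasDerivAt (fun l => h l s) (h1 l s) l) ∧ (∀ l s, h (-l) s = - h l s) ∧
      (∀ l s, h l s = l * |w l s| ^ m) := by
  set h : ℝ → ℝ → ℝ := fun l s => l * |w l s| ^ m with hh
  set h1 : ℝ → ℝ → ℝ := fun l s => |w l s| ^ m +
    m * |w l s| ^ (m-2) * w l s * (g1 l s - w l s) with hh1
  have hodd : ∀ l s, h (-l) s = - h l s := by
    intro l s; simp only [hh, R.even]; ring
  have ch : Continuous (fun z : ℝ × ℝ => h z.1 z.2) :=
    continuous_fst.mul (R.cw.abs.rpow_const (fun _ => Or.inr (by linarith)))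
  have ch1 : Continuous (fun z : ℝ × ℝ => h1 z.1 z.2) :=
    (R.cw.abs.rpow_const (fun _ => Or.inr (by linarith))).add
      (((continuous_const.mul (R.cw.abs.rpow_const (fun _ => Or.inr (by linarith)))).mul R.cw).mul
        (R.cg.sub R.cw))
  have cws : ∀ s, Continuous (fun l => w l s) := fun s =>
    R.cw.comp (by fun_prop : Continuous fun l : ℝ => ((l, s) : ℝ × ℝ))
  -- derivative at zero of `l * φ l`
  have dz : ∀ φ : ℝ → ℝ, Continuous φ → HasDerivAt (fun l => l * φ l) (φ 0) 0 := by
    intro φ hφ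
    rw [hasDerivAt_iff_tendsto_slope]
    have : Tendsto φ (𝓝[≠] 0) (𝓝 (φ 0)) := hφ.continuousAt.tendsto.mono_left nhdsWithin_le_nhds
    refine this.congr' ?_
    filter_upwards [self_mem_nhdsWithin] with x hx
    have hx' : x ≠ 0 := hx
    simp only [slope, vsub_eq_sub, smul_eq_mul, zero_mul, sub_zero]
    field_simp
  have g0 : ∀ s, g1 0 s = w 0 s := fun s => (R.hd 0 s).unique (dz _ (cws s))
  have hd : ∀ l s, HasDerivAt (fun l => h l s) (h1 l s) l := by
    intro l s
    by_cases hl : l = 0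
    · subst hl
      have e := dz (fun l => |w l s| ^ m) ((cws s).abs.rpow_const (fun _ => Or.inr (by linarith)))
      simpa [hh, hh1, g0] using e
    · have ew : HasDerivAt (fun l => w l s) ((g1 l s - w l s) / l) l := by
        have e1 := (R.hd l s).div (hasDerivAt_id l) hl
        have e2 : HasDerivAt (fun l => w l s) ((g1 l s * id l - l * w l s * 1) / id l ^ 2) l := by
          refine e1.congr_of_eventuallyEq ?_
          filter_upwards [isOpen_ne.mem_nhds hl] with x hx
          have hx' : x ≠ 0 := hx
          simp only [Pi.div_apply, id]
          field_simp
        convert e2 using 1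
        simp only [id]
        field_simp
      have e3 := (hasDerivAt_abs_rpow (w l s) (by linarith : 1 < m)).comp l ew
      have e4 := (hasDerivAt_id l).mul e3
      refine HasDerivAt.congr_deriv e4 ?_
      simp only [hh1, id, Function.comp]
      field_simp
  have heven : ∀ l s, h1 (-l) s = h1 l s := by
    intro l s
    have e1 : HasDerivAt (fun x => h (-x) s) (h1 (-l) s * (-1)) l :=
      HasDerivAt.comp l (h₂ := fun x => h x s) (hd (-l) s) (hasDerivAt_neg l)
    have e2 : HasDerivAt (fun x => h (-x) s) (-(h1 l s)) l := by
      have := (hd l s).neg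
      refine this.congr_of_eventuallyEq (Eventually.of_forall fun x => ?_)
      simp [hodd]
    have := e1.unique e2
    linarith
  have hmx : ∀ l s, h l s = h l (max s 0) := fun l s => by
    simp only [hh]; rw [← R.mw]
  have hmx1 : ∀ l s, h1 l s = h1 l (max s 0) := fun l s => by
    simp only [hh1]; rw [← R.mw, ← R.mg]
  -- basic power bounds
  have key : ∀ l s, 0 < l → 0 < s → |w l s| ^ (m-1) ≤
      B^(m-1) * ((1+l)^(-(m-1)) * (1+|l-s|)^(-(m-1))) := by
    intro l s hl hs
    have hX : 0 < 1 + l := by linarith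
    have hY : 0 < 1 + |l-s| := by positivity
    refine (Real.rpow_le_rpow (abs_nonneg _) (b1 l s hl hs) (by linarith)).trans (le_of_eq ?_)
    rw [Real.mul_rpow hB (by positivity), Real.mul_rpow (by positivity) (by positivity),
      Real.inv_rpow hX.le, Real.inv_rpow hY.le, Real.rpow_neg hX.le, Real.rpow_neg hY.le]
  have hpw : ∀ x : ℝ, 0 ≤ x → x ^ m = x ^ (m-1) * x := by
    intro x hx
    conv_lhs => rw [show m = (m-1) + 1 by ring]
    rw [Real.rpow_add_one' hx (by linarith)]
  have hYp : ∀ Y : ℝ, 0 < Y → Y ^ (-(m-1+1)) = Y ^ (-(m-1)) * Y⁻¹ := by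
    intro Y hY
    rw [← Real.rpow_neg_one Y, ← Real.rpow_add hY]; congr 1; ring
  refine ⟨h, h1, ?_, ?_, hd, hodd, fun l s => rfl⟩
  · refine KerBd_ext (by linarith) ch (fun l s => by rw [hodd, abs_neg]) hmx ?_
    intro l s hl hs
    have hX : 0 < 1 + l := by linarith
    have hY : 0 < 1 + |l-s| := by positivity
    have k1 := key l s hl hs
    have k2 := b1 l s hl hs
    simp only [hh]
    rw [hYp _ hY, abs_mul, abs_of_pos hl, abs_of_nonneg (by positivity : 0 ≤ |w l s| ^ m),
      hpw _ (abs_nonneg _), hpw B hB]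
    set P := (1+l)^(-(m-1)) with hPd
    set Q := (1+|l-s|)^(-(m-1)) with hQd
    have hP : 0 < P := by positivity
    have hQ : 0 < Q := by positivity
    have hBm : 0 ≤ B ^ (m-1) := by positivity
    have hYi : 0 < (1+|l-s|)⁻¹ := by positivity
    have h3 : |w l s| ^ (m-1) * |w l s| ≤ (B^(m-1) * (P * Q)) * (B * ((1+l)⁻¹ * (1+|l-s|)⁻¹)) :=
      mul_le_mul k1 k2 (abs_nonneg _) (by positivity)
    have h4 : l * (1+l)⁻¹ ≤ 1 := by
      rw [← div_eq_mul_inv, div_le_one hX]; linarith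
    calc l * (|w l s| ^ (m-1) * |w l s|)
        ≤ l * ((B^(m-1) * (P * Q)) * (B * ((1+l)⁻¹ * (1+|l-s|)⁻¹))) :=
          mul_le_mul_of_nonneg_left h3 hl.le
      _ = (l * (1+l)⁻¹) * ((B^(m-1) * B) * (P * (Q * (1+|l-s|)⁻¹))) := by ring
      _ ≤ (m+1) * ((B^(m-1) * B) * (P * (Q * (1+|l-s|)⁻¹))) :=
          mul_le_mul_of_nonneg_right (by linarith) (by positivity)
      _ = _ := by ring
  · refine KerBd_ext (by linarith) ch1 (fun l s => by rw [heven]) hmx1 ?_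
    intro l s hl hs
    have hX : 0 < 1 + l := by linarith
    have hY : 0 < 1 + |l-s| := by positivity
    have k1 := key l s hl hs
    have k2 := b1 l s hl hs
    have k3 := b2 l s hl hs
    simp only [hh1]
    rw [hYp _ hY, hpw B hB]
    set P := (1+l)^(-(m-1)) with hPd
    set Q := (1+|l-s|)^(-(m-1)) with hQd
    have hP : 0 < P := by positivity
    have hQ : 0 < Q := by positivity
    have hBm : 0 ≤ B ^ (m-1) := by positivity
    have hYi : 0 < (1+|l-s|)⁻¹ := by positivity
    have hXi : (1+l)⁻¹ ≤ 1 := inv_le_one_of_one_le₀ (by linarith)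
    have k2' : |w l s| ≤ B * (1+|l-s|)⁻¹ := by
      refine k2.trans (mul_le_mul_of_nonneg_left ?_ hB)
      nlinarith
    have a1 : |(|w l s| ^ m)| ≤ (B^(m-1) * (P * Q)) * (B * (1+|l-s|)⁻¹) := by
      rw [abs_of_nonneg (by positivity), hpw _ (abs_nonneg _)]
      exact mul_le_mul k1 k2' (abs_nonneg _) (by positivity)
    have a2 : |m * |w l s| ^ (m-2) * w l s * (g1 l s - w l s)| ≤
        m * ((B^(m-1) * (P * Q)) * (B * (1+|l-s|)⁻¹)) := by
      have e : |w l s| ^ (m-2) * |w l s| = |w l s| ^ (m-1) := by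
        rw [← Real.rpow_add_one' (abs_nonneg _) (by linarith)]; congr 1; ring
      have : |m * |w l s| ^ (m-2) * w l s * (g1 l s - w l s)| =
          m * (|w l s| ^ (m-1) * |g1 l s - w l s|) := by
        rw [abs_mul, abs_mul, abs_mul, abs_of_pos (by linarith : 0 < m),
          abs_of_nonneg (by positivity : 0 ≤ |w l s| ^ (m-2)), ← e]; ring
      rw [this]
      exact mul_le_mul_of_nonneg_left (mul_le_mul k1 k3 (abs_nonneg _) (by positivity))
        (by linarith)
    refine (abs_add_le _ _).trans ((add_le_add a1 a2).trans (le_of_eq ?_))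
    ring

end Nonlinear


section KopBounds

lemma ext_even {φ : ℝ → ℝ} {e : ℝ} (hc : Continuous φ) (hs : ∀ x, |φ (-x)| = |φ x|)
    (hb : ∀ x, 0 < x → (1 + x) * |φ x| ≤ e) (x : ℝ) : |φ x| ≤ e / (1 + |x|) := by
  have hcl : IsClosed {x : ℝ | (1 + x) * |φ x| ≤ e} :=
    isClosed_le (by fun_prop) continuous_const
  have hsub : closure (Ioi (0:ℝ)) ⊆ {x : ℝ | (1 + x) * |φ x| ≤ e} :=
    hcl.closure_subset_iff.2 (fun s hs => hb s hs)
  rw [closure_Ioi] at hsub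
  have h3 : (1 + |x|) * |φ (|x|)| ≤ e := @hsub (|x|) (abs_nonneg x)
  have h4 : |φ (|x|)| = |φ x| := by
    rcases abs_choice x with h | h
    · rw [h]
    · rw [h, hs]
  rw [h4] at h3
  rw [le_div_iff₀ (by positivity)]
  linarith

lemma deriv_odd_even {a : ℝ → ℝ} (h : ∀ x, a (-x) = -a x) (x : ℝ) :
    deriv a (-x) = deriv a x := by
  have h1 := deriv_comp_neg a x
  have h2 : (fun x => a (-x)) = fun x => -a x := funext h
  rw [h2, deriv.fun_neg] at h1
  linarith

lemma deriv_even_odd {a : ℝ → ℝ} (h : ∀ x, a (-x) = a x) (x : ℝ) :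
    deriv a (-x) = -deriv a x := by
  have h1 := deriv_comp_neg a x
  have h2 : (fun x => a (-x)) = a := funext h
  rw [h2] at h1
  linarith

lemma data_c {ν ε : ℝ} (hν : 1 ≤ ν) {fg : (ℝ → ℝ) × (ℝ → ℝ)} (H : memY ν ε fg) :
    ∃ c c1 : ℝ → ℝ, (∀ x, HasDerivAt c (c1 x) x) ∧
      (∀ x, |c x| ≤ 4 * ε / (1 + |x|)) ∧ (∀ x, |c1 x| ≤ 4 * ε / (1 + |x|)) ∧
      (∀ r t, 0 < r → HasDerivAt (fun t' => Kop fg r t') ((c (t + r) - c (t - r)) / (2 * r)) t) := by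
  obtain ⟨f, g⟩ := fg
  obtain ⟨hf, hg, fe, ge, ha, hb, hT⟩ := H
  simp only at hf hg fe ge ha hb
  set a : ℝ → ℝ := fun x => x * f x with had
  set b : ℝ → ℝ := fun x => x * g x with hbd
  have dfa : ∀ x, HasDerivAt f (deriv f x) x := fun x =>
    (hf.differentiable (by norm_num) x).hasDerivAt
  have daa : ∀ x, HasDerivAt a (deriv a x) x := fun x =>
    (ha.differentiable (by norm_num) x).hasDerivAt
  have ha1 : ContDiff ℝ 1 (deriv a) := by
    have : ContDiff ℝ (1+1) a := by simpa [one_add_one_eq_two] using ha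
    exact (contDiff_succ_iff_deriv.1 this).2.2
  have daa2 : ∀ x, HasDerivAt (deriv a) (deriv (deriv a) x) x := fun x =>
    (ha1.differentiable (by norm_num) x).hasDerivAt
  have dba : ∀ x, HasDerivAt b (deriv b x) x := fun x =>
    (hb.differentiable (by norm_num) x).hasDerivAt
  have ca2 : Continuous (deriv (deriv a)) := ha1.continuous_deriv le_rfl
  have cb1 : Continuous (deriv b) := hb.continuous_deriv le_rfl
  have aodd : ∀ x, a (-x) = -a x := fun x => by simp only [had, fe]; ring
  have bodd : ∀ x, b (-x) = -b x := fun x => by simp only [hbd, ge]; ring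
  have a1e := deriv_odd_even aodd
  have a2o := deriv_even_odd a1e
  have b1e := deriv_odd_even bodd
  have a1f : ∀ x, deriv a x = f x + x * deriv f x := fun x => by
    have := ((hasDerivAt_id x).mul (dfa x))
    have h2 : HasDerivAt a (1 * f x + id x * deriv f x) x := this
    rw [h2.deriv]; simp
  have a2f : ∀ x, 0 < x → deriv (deriv a) x = 2 * deriv f x + x * deriv (deriv f) x := by
    intro x hx
    have e1 : DifferentiableAt ℝ (deriv f) x := by
      have e2 : DifferentiableAt ℝ (fun y => (deriv a y - f y) / y) x :=
        ((daa2 x).differentiableAt.sub (dfa x).differentiableAt).div differentiableAt_id hx.ne'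
      refine e2.congr_of_eventuallyEq ?_
      filter_upwards [Ioi_mem_nhds hx] with y hy
      have hy' : y ≠ 0 := ne_of_gt hy
      rw [a1f]; field_simp; ring
    have e3 : HasDerivAt (fun y => f y + y * deriv f y)
        (deriv f x + (1 * deriv f x + id x * deriv (deriv f) x)) x :=
      (dfa x).add ((hasDerivAt_id x).mul e1.hasDerivAt)
    have e4 : deriv a = fun y => f y + y * deriv f y := funext a1f
    rw [e4, e3.deriv]; simp only [id]; ring
  have b1f : ∀ x, 0 < x → deriv b x = g x + x * deriv g x := by
    intro x hx
    have e1 : DifferentiableAt ℝ g x := by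
      have e2 : DifferentiableAt ℝ (fun y => b y / y) x :=
        (dba x).differentiableAt.div differentiableAt_id hx.ne'
      refine e2.congr_of_eventuallyEq ?_
      filter_upwards [Ioi_mem_nhds hx] with y hy
      have hy' : y ≠ 0 := ne_of_gt hy
      simp only [hbd]; field_simp
    have e3 : HasDerivAt b (1 * g x + id x * deriv g x) x :=
      (hasDerivAt_id x).mul e1.hasDerivAt
    rw [e3.deriv]; simp
  -- bounds for positive x
  have hT' : ∀ x, 0 < x → (1 + x) * (|f x| + (1 + x) * (|deriv f x| + |g x|) +
      x * (|deriv (deriv f) x| + |deriv g x|)) ≤ ε := by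
    intro x hx
    have h1 := hT x hx
    simp only [tnorm, tripleNorm] at h1
    refine le_trans (mul_le_mul_of_nonneg_right ?_ (by positivity)) h1
    calc (1 + x) = (1 + x) ^ (1:ℝ) := (Real.rpow_one _).symm
      _ ≤ _ := Real.rpow_le_rpow_of_exponent_le (by linarith) hν
  have bd : ∀ x y, 0 < x → y ≤ 2 * (|f x| + (1 + x) * (|deriv f x| + |g x|) +
      x * (|deriv (deriv f) x| + |deriv g x|)) → (1 + x) * y ≤ 2 * ε := by
    intro x y hx hy
    have := hT' x hx
    have h2 := mul_le_mul_of_nonneg_left hy (by linarith : 0 ≤ 1 + x)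
    linarith
  have B1 := ext_even (φ := deriv a) (e := 2 * ε) ha1.continuous (fun x => by rw [a1e]) (by
    intro x hx
    apply bd x _ hx
    rw [a1f]
    refine (abs_add_le _ _).trans ?_
    rw [abs_mul, abs_of_pos hx]
    have h1 := abs_nonneg (f x)
    have h2 := abs_nonneg (deriv f x)
    have h3 := mul_nonneg hx.le h2
    have h4 : 0 ≤ (1 + x) * |g x| := by positivity
    have h5 : 0 ≤ x * (|deriv (deriv f) x| + |deriv g x|) := by positivity
    linarith)
  have B2 := ext_even (φ := b) (e := 2 * ε) hb.continuous (fun x => by rw [bodd, abs_neg]) (by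
    intro x hx
    apply bd x _ hx
    simp only [hbd]
    rw [abs_mul, abs_of_pos hx]
    have h1 := abs_nonneg (f x)
    have h2 : 0 ≤ (1 + x) * |deriv f x| := by positivity
    have h3 := abs_nonneg (g x)
    have h4 : 0 ≤ x * |g x| := by positivity
    have h5 : 0 ≤ x * (|deriv (deriv f) x| + |deriv g x|) := by positivity
    linarith)
  have B3 := ext_even (φ := deriv (deriv a)) (e := 2 * ε) ca2
    (fun x => by rw [a2o, abs_neg]) (by
    intro x hx
    apply bd x _ hx
    rw [a2f x hx]
    refine (abs_add_le _ _).trans ?_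
    rw [abs_mul, abs_mul, abs_of_pos hx, abs_two]
    have h1 := abs_nonneg (f x)
    have h2 : 0 ≤ x * |deriv f x| := by positivity
    have h3 : 0 ≤ (1 + x) * |g x| := by positivity
    have h4 : 0 ≤ x * |deriv g x| := by positivity
    have h5 : 0 ≤ x * |deriv (deriv f) x| := by positivity
    linarith)
  have B4 := ext_even (φ := deriv b) (e := 2 * ε) cb1 (fun x => by rw [b1e]) (by
    intro x hx
    apply bd x _ hx
    rw [b1f x hx]
    refine (abs_add_le _ _).trans ?_
    rw [abs_mul, abs_of_pos hx]
    have h1 := abs_nonneg (f x)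
    have h2 : 0 ≤ (1 + x) * |deriv f x| := by positivity
    have h3 : 0 ≤ x * |g x| := by positivity
    have h0 := abs_nonneg (g x)
    have h4 : 0 ≤ x * |deriv g x| := by positivity
    have h5 : 0 ≤ x * |deriv (deriv f) x| := by positivity
    linarith)
  have hsum : ∀ x, 2 * ε / (1 + |x|) + 2 * ε / (1 + |x|) = 4 * ε / (1 + |x|) := fun x => by ring
  refine ⟨fun x => deriv a x + b x, fun x => deriv (deriv a) x + deriv b x,
    fun x => (daa2 x).add (dba x), ?_, ?_, ?_⟩
  · intro x
    rw [← hsum]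
    exact (abs_add_le _ _).trans (add_le_add (B1 x) (B2 x))
  · intro x
    rw [← hsum]
    exact (abs_add_le _ _).trans (add_le_add (B3 x) (B4 x))
  · intro r t hr
    have ci : ∀ (φ : ℝ → ℝ), Continuous φ → ∀ s, HasDerivAt
        (fun s : ℝ => ∫ l in (r - s)..(r + s), φ l) (φ (r + s) + φ (r - s)) s := by
      intro φ hφ s
      have e : (fun s : ℝ => ∫ l in (r - s)..(r + s), φ l) =
          fun s => (∫ l in (0:ℝ)..(r + s), φ l) - ∫ l in (0:ℝ)..(r - s), φ l := by
        funext s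
        rw [intervalIntegral.integral_interval_sub_left] <;>
          exact hφ.intervalIntegrable _ _
      rw [e]
      have F : ∀ x, HasDerivAt (fun x => ∫ l in (0:ℝ)..x, φ l) (φ x) x := fun x =>
        (hφ.integral_hasStrictDerivAt 0 x).hasDerivAt
      have e1 : HasDerivAt (fun s : ℝ => r + s) 1 s := by
        simpa using (hasDerivAt_id s).const_add r
      have e2 : HasDerivAt (fun s : ℝ => r - s) (-1) s := by
        simpa using (hasDerivAt_id s).const_sub r
      have e3 := ((F (r + s)).comp s e1).sub ((F (r - s)).comp s e2)
      refine HasDerivAt.congr_deriv e3 ?_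
      ring
    have eK : (fun t' => Kop (f, g) r t') = fun t' => (1 / (2 * r)) *
        ((∫ l in (r - t')..(r + t'), b l) + (a (r + t') + a (r - t'))) := by
      funext t'
      have e5 : deriv (fun s : ℝ => ∫ l in (r - s)..(r + s), l * f l) t' =
          a (r + t') + a (r - t') := (ci a ha.continuous t').deriv
      simp only [Kop]
      rw [e5]
    rw [eK]
    have e1 : HasDerivAt (fun s : ℝ => r + s) 1 t := by
      simpa using (hasDerivAt_id t).const_add r
    have e2 : HasDerivAt (fun s : ℝ => r - s) (-1) t := by
      simpa using (hasDerivAt_id t).const_sub r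
    have e3 := ((daa (r + t)).comp t e1).add ((daa (r - t)).comp t e2)
    have e4 := ((ci b hb.continuous t).add e3).const_mul (1 / (2 * r))
    refine HasDerivAt.congr_deriv e4 ?_
    have q1 : deriv a (r - t) = deriv a (t - r) := by rw [← a1e]; congr 1; ring
    have q2 : b (r - t) = - b (t - r) := by rw [← bodd]; congr 1; ring
    rw [q1, q2, add_comm r t]
    field_simp
    ring

lemma Kt_bounds {c c1 : ℝ → ℝ} {ε : ℝ} (hd : ∀ x, HasDerivAt c (c1 x) x)
    (hc : ∀ x, |c x| ≤ 4 * ε / (1 + |x|)) (hc1 : ∀ x, |c1 x| ≤ 4 * ε / (1 + |x|))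
    (hε : 0 < ε) {r t : ℝ} (hr : 0 < r) (ht : 0 < t) :
    |(c (t + r) - c (t - r)) / (2 * r)| ≤ 24 * ε * ((1 + r)⁻¹ * (1 + |r - t|)⁻¹) ∧
    ∃ d, HasDerivAt (fun r => (c (t + r) - c (t - r)) / (2 * r)) d r ∧
      r * |d| ≤ 28 * ε * (1 + |r - t|)⁻¹ := by
  set Y := 1 + |r - t| with hY
  have hYp : 0 < Y := by positivity
  have hYi : 0 < Y⁻¹ := by positivity
  have y1 : Y ≤ 1 + |t + r| := by
    rw [hY, abs_of_pos (by linarith : 0 < t + r)]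
    have : |r - t| ≤ t + r := abs_le.2 ⟨by linarith, by linarith⟩
    linarith
  have y2 : Y = 1 + |t - r| := by rw [hY, abs_sub_comm]
  have comp : ∀ x, Y ≤ 1 + |x| → 4 * ε / (1 + |x|) ≤ 4 * ε * Y⁻¹ := by
    intro x hx
    rw [← div_eq_mul_inv]
    exact div_le_div_of_nonneg_left (by linarith) hYp hx
  have hK : |(c (t + r) - c (t - r)) / (2 * r)| ≤ 24 * ε * ((1 + r)⁻¹ * Y⁻¹) := by
    rw [abs_div, abs_of_pos (by linarith : 0 < 2 * r)]
    rcases le_total 1 r with h1 | h1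
    · have e1 : |c (t + r) - c (t - r)| ≤ 8 * ε * Y⁻¹ := by
        have := (abs_sub _ _).trans (add_le_add ((hc (t + r)).trans (comp _ y1))
          ((hc (t - r)).trans (comp _ y2.le)))
        linarith
      rw [div_le_iff₀ (by linarith)]
      refine e1.trans ?_
      have : 1 ≤ (1 + r)⁻¹ * (2 * r) := by
        rw [← div_eq_inv_mul, le_div_iff₀ (by linarith)]; linarith
      have h2 : 0 < 24 * ε * Y⁻¹ := by positivity
      nlinarith
    · obtain ⟨ξ, hξ, hξ'⟩ := exists_hasDerivAt_eq_slope c c1 (by linarith : t - r < t + r)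
        (fun x _ => (hd x).continuousAt.continuousWithinAt) (fun x _ => hd x)
      have e0 : |c (t + r) - c (t - r)| / (2 * r) = |c1 ξ| := by
        rw [hξ', abs_div]
        congr 1
        rw [show t + r - (t - r) = 2 * r by ring, abs_of_pos (by linarith)]
      rw [e0]
      refine (hc1 ξ).trans ?_
      have e1 : Y ≤ 3 * (1 + |ξ|) := by
        rw [y2]
        have : |t - r| ≤ |ξ| + 2 := by
          have h3 : |t - r| ≤ |ξ| + |t - r - ξ| := by
            have := abs_add_le ξ (t - r - ξ); simpa using this
          have h4 : |t - r - ξ| ≤ 2 := abs_le.2 ⟨by linarith [hξ.2], by linarith [hξ.1]⟩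
          linarith
        linarith [abs_nonneg ξ]
      have e2 : 4 * ε / (1 + |ξ|) ≤ 12 * ε * Y⁻¹ := by
        rw [← div_eq_mul_inv, div_le_div_iff₀ (by positivity) hYp]
        nlinarith
      have e3 : 1 ≤ 2 * (1 + r)⁻¹ := by
        rw [← div_eq_mul_inv, le_div_iff₀ (by linarith)]; linarith
      have h2 : 0 < 12 * ε * Y⁻¹ := by positivity
      nlinarith
  refine ⟨hK, (c1 (t + r) + c1 (t - r)) / (2 * r) - (c (t + r) - c (t - r)) / (2 * r) / r, ?_, ?_⟩
  · have e1 : HasDerivAt (fun s : ℝ => t + s) 1 r := by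
      simpa using (hasDerivAt_id r).const_add t
    have e2 : HasDerivAt (fun s : ℝ => t - s) (-1) r := by
      simpa using (hasDerivAt_id r).const_sub t
    have e3 := (((hd (t + r)).comp r e1).sub ((hd (t - r)).comp r e2)).div
      ((hasDerivAt_id r).const_mul 2) (by simpa using hr.ne')
    refine HasDerivAt.congr_deriv e3 ?_
    simp only [id, Pi.sub_apply, Function.comp]
    field_simp
    ring
  · set K := (c (t + r) - c (t - r)) / (2 * r) with hKd
    have e1 : r * |(c1 (t + r) + c1 (t - r)) / (2 * r) - K / r| =
        |(c1 (t + r) + c1 (t - r)) / 2 - K| := by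
      conv_lhs => rw [← abs_of_pos hr]
      rw [← abs_mul]
      rw [abs_of_pos hr]
      congr 1
      field_simp
    rw [e1]
    have e2 : |(c1 (t + r) + c1 (t - r)) / 2| ≤ 4 * ε * Y⁻¹ := by
      rw [abs_div, abs_two]
      have := (abs_add_le _ _).trans (add_le_add ((hc1 (t + r)).trans (comp _ y1))
          ((hc1 (t - r)).trans (comp _ y2.le)))
      linarith
    have e3 : |K| ≤ 24 * ε * Y⁻¹ := by
      refine hK.trans ?_
      have : (1 + r)⁻¹ ≤ 1 := inv_le_one_of_one_le₀ (by linarith)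
      have h2 : 0 < 24 * ε * Y⁻¹ := by positivity
      nlinarith
    have := abs_sub ((c1 (t + r) + c1 (t - r)) / 2) K
    linarith

/-- Pointwise bounds for the regularized time derivative. -/
lemma w_bounds {ν ε : ℝ} (hν : 1 ≤ ν) (hε : 0 < ε) {fg : (ℝ → ℝ) × (ℝ → ℝ)}
    (H : memY ν ε fg) {u w g1 : ℝ → ℝ → ℝ} (R : RegW w g1)
    (hw : ∀ r t, 0 < t → HasDerivAt (fun t' => u r t') (w r t) t)
    (hz : ∀ x ∈ ZSet 2 ν (u - Kop fg), x ≤ ε) {r t : ℝ} (hr : 0 < r) (ht : 0 < t) :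
    |w r t| ≤ (30 * ε) * ((1 + r)⁻¹ * (1 + |r - t|)⁻¹) ∧
    |g1 r t - w r t| ≤ (30 * ε) * (1 + |r - t|)⁻¹ := by
  obtain ⟨c, c1, hd, hc, hc1, hK⟩ := data_c hν H
  obtain ⟨k1, d, hdd, k2⟩ := Kt_bounds hd hc hc1 hε hr ht
  set Y := 1 + |r - t| with hY
  have hYp : 0 < Y := by positivity
  set z := u - Kop fg with hzd
  have pz : ∀ r', 0 < r' → pdt z r' t = w r' t - (c (t + r') - c (t - r')) / (2 * r') := by
    intro r' hr'
    have := (hw r' t ht).sub (hK r' t hr')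
    exact HasDerivAt.deriv this
  have ew : HasDerivAt (fun l => w l t) ((g1 r t - w r t) / r) r := by
    have e1 := (R.hd r t).div (hasDerivAt_id r) hr.ne'
    have e2 : HasDerivAt (fun l => w l t) ((g1 r t * id r - r * w r t * 1) / id r ^ 2) r := by
      refine e1.congr_of_eventuallyEq ?_
      filter_upwards [isOpen_ne.mem_nhds hr.ne'] with x hx
      have hx' : x ≠ 0 := hx
      simp only [Pi.div_apply, id]
      field_simp
    refine e2.congr_deriv ?_
    simp only [id]
    field_simp
  have pz2 : pdr (pdt z) r t = (g1 r t - w r t) / r - d := by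
    have e1 := ew.sub hdd
    have e2 : HasDerivAt (fun r' => pdt z r' t) ((g1 r t - w r t) / r - d) r := by
      refine e1.congr_of_eventuallyEq ?_
      filter_upwards [Ioi_mem_nhds hr] with x hx
      rw [pz x hx]; rfl
    exact e2.deriv
  have hb : bracket2 z r t * Y ≤ ε := by
    have h1 := hz _ ⟨r, t, hr, ht.le, rfl⟩
    simp only [bracketS, if_neg (by norm_num : ¬ (2:ℕ) = 1)] at h1
    refine le_trans ?_ h1
    have h0 : 0 ≤ bracket2 z r t := by unfold bracket2; positivity
    have h2 : 1 ≤ (1 + r + t) ^ (ν - 1) := Real.one_le_rpow (by linarith) (by linarith)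
    refine mul_le_mul_of_nonneg_right ?_ hYp.le
    nlinarith
  have hb' : bracket2 z r t ≤ ε * Y⁻¹ := by
    rw [← div_eq_mul_inv, le_div_iff₀ hYp]; exact hb
  unfold bracket2 at hb'
  have n1 := abs_nonneg (z r t)
  have n2 : 0 ≤ (1 + r) * |pdr z r t| := by positivity
  have n3 : 0 ≤ (1 + r) * |pdt z r t| := by positivity
  have n4 : 0 ≤ r * |pdr (pdr z) r t| := by positivity
  have n5 : 0 ≤ r * |pdr (pdt z) r t| := by positivity
  have n6 : 0 ≤ r * |pdt (pdt z) r t| := by positivity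
  have m1 : |pdt z r t| ≤ ε * ((1 + r)⁻¹ * Y⁻¹) := by
    have : (1 + r) * |pdt z r t| ≤ ε * Y⁻¹ := by linarith
    calc |pdt z r t| = (1 + r)⁻¹ * ((1 + r) * |pdt z r t|) := by field_simp
      _ ≤ (1 + r)⁻¹ * (ε * Y⁻¹) := mul_le_mul_of_nonneg_left this (by positivity)
      _ = _ := by ring
  have m2 : r * |pdr (pdt z) r t| ≤ ε * Y⁻¹ := by linarith
  constructor
  · have e : w r t = pdt z r t + (c (t + r) - c (t - r)) / (2 * r) := by rw [pz r hr]; ring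
    rw [e]
    have hp : 0 < ε * ((1 + r)⁻¹ * Y⁻¹) := by positivity
    have := (abs_add_le (pdt z r t) ((c (t + r) - c (t - r)) / (2 * r)))
    linarith
  · have e : g1 r t - w r t = r * pdr (pdt z) r t + r * d := by rw [pz2]; field_simp; ring
    rw [e]
    have hp : 0 < ε * Y⁻¹ := by positivity
    have := abs_add_le (r * pdr (pdt z) r t) (r * d)
    rw [abs_mul, abs_mul, abs_of_pos hr] at this
    linarith

/-- The main estimate for one component. -/
lemma component_bound {m ν ε : ℝ} (hm : 2 < m) (hν : 1 ≤ ν) (hε : 0 < ε)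
    {fg : (ℝ → ℝ) × (ℝ → ℝ)} (H : memY ν ε fg) {u : ℝ → ℝ → ℝ} (hu : memX 2 u)
    (hz : ∀ x ∈ ZSet 2 ν (u - Kop fg), x ≤ ε) :
    ∀ x ∈ ZSet 2 (m - 1) (Rop (NLt m u)), x ≤ (CR (m-1) * ((m+1) * 30^m)) * ε^m := by
  obtain ⟨w, g1, R, hw⟩ := memX_reg hu
  obtain ⟨h, h1, K1, K2, hd, hodd, hdef⟩ := nonlin_ker hm (by positivity : 0 ≤ 30 * ε) R
    (fun l s hl hs => (w_bounds hν hε H R hw hz hl hs).1)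
    (fun l s hl hs => (w_bounds hν hε H R hw hz hl hs).2)
  rintro x ⟨r, t, hr, ht, rfl⟩
  have hF : ∀ l s, 0 < s → l * NLt m u l s = h l s := by
    intro l s hs
    have : pdt u l s = w l s := (hw l s hs).deriv
    rw [hdef, NLt, this]
  have hL := linear_bound (by linarith : 1 < m - 1) K1 K2 hd hodd hF hr ht
  simp only [bracketS, if_neg (by norm_num : ¬ (2:ℕ) = 1)]
  have hX : 0 < 1 + r + t := by linarith
  have hY : 0 < 1 + |r - t| := by positivity
  have hP : 0 < (1 + r + t) ^ (m - 1 - 1) := by positivity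
  have e1 : Tw (m-1) r t * (1 + r + t) ^ (m - 1 - 1) * (1 + |r - t|) = 1 := by
    unfold Tw
    rw [Real.rpow_neg hX.le]
    field_simp
  calc bracket2 (Rop (NLt m u)) r t * (1 + r + t) ^ (m - 1 - 1) * (1 + |r - t|)
      ≤ (CR (m-1) * ((m+1) * (30*ε)^m) * Tw (m-1) r t) * (1 + r + t) ^ (m - 1 - 1) *
        (1 + |r - t|) := by gcongr
    _ = CR (m-1) * ((m+1) * (30*ε)^m) *
        (Tw (m-1) r t * (1 + r + t) ^ (m - 1 - 1) * (1 + |r - t|)) := by ring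
    _ = _ := by rw [e1, Real.mul_rpow (by norm_num) hε.le]; ring

lemma Znorm_nonneg (ν : ℝ) (u : ℝ → ℝ → ℝ) : 0 ≤ Znorm 2 ν u := by
  apply Real.sSup_nonneg
  rintro x ⟨r, t, hr, ht, rfl⟩
  simp only [bracketS, if_neg (by norm_num : ¬ (2:ℕ) = 1), bracket2]
  have : 0 < 1 + r + t := by linarith
  positivity

lemma ZSet_nonempty (ν : ℝ) (u : ℝ → ℝ → ℝ) : (ZSet 2 ν u).Nonempty :=
  ⟨_, 1, 0, one_pos, le_rfl, rfl⟩

end KopBounds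


end Helpers

/-- **Lemma 4.1, estimates (ko6)/(ko7).** For `p > 2`, `p ≤ q`, `0 < ε ≤ 1` and
`(u₁, u₂) ∈ D_ε` (i.e. `‖u₁ - K[f⃗₁]‖_{Z²(κ₁)} + ‖u₂ - K[f⃗₂]‖_{Z²(κ₂)} ≤ ε`):
`‖R(|∂_t u₂|^p)‖_{Z²(κ₁)} ≤ C ε^p` and `‖R(|∂_t u₁|^q)‖_{Z²(κ₂)} ≤ C ε^q`. -/
theorem stmt9 (p q : ℝ) (hp : 2 < p) (hpq : p ≤ q) :
    ∃ C > 0, ∀ ε : ℝ, 0 < ε → ε ≤ 1 →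
      ∀ fg1 fg2 : (ℝ → ℝ) × (ℝ → ℝ), memY (p - 1) ε fg1 → memY (q - 1) ε fg2 →
      ∀ u₁ u₂ : ℝ → ℝ → ℝ, memX 2 u₁ → memX 2 u₂ →
        BddAbove (ZSet 2 (p - 1) (u₁ - Kop fg1)) →
        BddAbove (ZSet 2 (q - 1) (u₂ - Kop fg2)) →
        Znorm 2 (p - 1) (u₁ - Kop fg1) + Znorm 2 (q - 1) (u₂ - Kop fg2) ≤ ε →
        (BddAbove (ZSet 2 (p - 1) (Rop (NLt p u₂))) ∧
          Znorm 2 (p - 1) (Rop (NLt p u₂)) ≤ C * ε ^ p) ∧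
        (BddAbove (ZSet 2 (q - 1) (Rop (NLt q u₁))) ∧
          Znorm 2 (q - 1) (Rop (NLt q u₁)) ≤ C * ε ^ q) := by
  refine ⟨max 1 (max (CR (p-1) * ((p+1) * 30^p)) (CR (q-1) * ((q+1) * 30^q))),
    lt_max_of_lt_left one_pos, ?_⟩
  intro ε hε _ fg1 fg2 H1 H2 u₁ u₂ hu1 hu2 hb1 hb2 hsum
  have z1 : ∀ x ∈ ZSet 2 (p - 1) (u₁ - Kop fg1), x ≤ ε := by
    intro x hx
    have e1 : x ≤ Znorm 2 (p - 1) (u₁ - Kop fg1) := le_csSup hb1 hx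
    linarith [Znorm_nonneg (q - 1) (u₂ - Kop fg2)]
  have z2 : ∀ x ∈ ZSet 2 (q - 1) (u₂ - Kop fg2), x ≤ ε := by
    intro x hx
    have e1 : x ≤ Znorm 2 (q - 1) (u₂ - Kop fg2) := le_csSup hb2 hx
    linarith [Znorm_nonneg (p - 1) (u₁ - Kop fg1)]
  have c1 := component_bound hp (by linarith : 1 ≤ q - 1) hε H2 hu2 z2
  have c2 := component_bound (by linarith : 2 < q) (by linarith : 1 ≤ p - 1) hε H1 hu1 z1
  refine ⟨⟨⟨_, fun x hx => c1 x hx⟩, ?_⟩, ⟨⟨_, fun x hx => c2 x hx⟩, ?_⟩⟩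
  · refine (csSup_le (ZSet_nonempty _ _) c1).trans ?_
    exact mul_le_mul_of_nonneg_right ((le_max_left _ _).trans (le_max_right _ _)) (by positivity)
  · refine (csSup_le (ZSet_nonempty _ _) c2).trans ?_
    exact mul_le_mul_of_nonneg_right ((le_max_right _ _).trans (le_max_right _ _)) (by positivity)
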